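/- For every nonnegative integer n, a̅₅(5n+3) = 4·c₅(5n+2). -/

import Mathlib

open scoped BigOperators

/-- The q-Pochhammer infinite product `(a; q)_∞ = ∏_{k≥0} (1 - a q^k)`. -/
noncomputable def qpoch (a q : ℂ) : ℂ := ∏' k : ℕ, (1 - a * q ^ k)

/-- `φ(-q) = (q;q)_∞² / (q²;q²)_∞`. -/
noncomputable def phiNeg (q : ℂ) : ℂ := qpoch q q ^ 2 / qpoch (q ^ 2) (q ^ 2)

/-- `ψ(-q) = (q;q)_∞ (q⁴;q⁴)_∞ / (q²;q²)_∞`. -/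
noncomputable def psiNeg (q : ℂ) : ℂ :=
  qpoch q q * qpoch (q ^ 4) (q ^ 4) / qpoch (q ^ 2) (q ^ 2)

open Filter Topology

lemma qp_summable (a q : ℂ) (hq : ‖q‖ < 1) : Summable (fun k : ℕ => ‖-(a * q ^ k)‖) := by
  simp only [norm_neg, norm_mul, norm_pow]
  exact (summable_geometric_of_lt_one (norm_nonneg q) hq).mul_left _

lemma qp_mult (a q : ℂ) (hq : ‖q‖ < 1) : Multipliable (fun k : ℕ => (1 - a * q ^ k)) := by
  have := multipliable_one_add_of_summable (qp_summable a q hq)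
  simpa [sub_eq_add_neg] using this

lemma qp_tendsto (a q : ℂ) (hq : ‖q‖ < 1) :
    Tendsto (fun N : ℕ => ∏ k ∈ Finset.range N, (1 - a * q ^ k)) atTop (𝓝 (qpoch a q)) :=
  (qp_mult a q hq).tendsto_prod_tprod_nat

lemma qp_ne_zero (a q : ℂ) (hq : ‖q‖ < 1) (h : ∀ k : ℕ, a * q ^ k ≠ 1) : qpoch a q ≠ 0 := by
  have := tprod_one_add_ne_zero_of_summable (f := fun k : ℕ => -(a * q ^ k)) ?_ (qp_summable a q hq)
  · simpa [sub_eq_add_neg, qpoch] using this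
  · intro k hk
    apply h k
    linear_combination -hk

lemma qp_ne_zero' (a q : ℂ) (hq : ‖q‖ < 1) (ha : ‖a‖ < 1) : qpoch a q ≠ 0 := by
  apply qp_ne_zero a q hq
  intro k hk
  have h1 : ‖a * q ^ k‖ < 1 := by
    rw [norm_mul, norm_pow]
    calc ‖a‖ * ‖q‖ ^ k ≤ ‖a‖ * 1 := by
          gcongr; exact pow_le_one₀ (norm_nonneg _) hq.le
      _ < 1 := by simpa using ha
  rw [hk] at h1
  simp at h1

lemma prod_range_split (f : ℕ → ℂ) (m N : ℕ) :
    ∏ k ∈ Finset.range (m * N), f k = ∏ j ∈ Finset.range m, ∏ k ∈ Finset.range N, f (m * k + j) := by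
  rw [Finset.prod_comm]
  induction N with
  | zero => simp
  | succ N ih => rw [Nat.mul_succ, Finset.prod_range_add, Finset.prod_range_succ, ih]

lemma qp_split (m : ℕ) (hm : 0 < m) (a q : ℂ) (hq : ‖q‖ < 1) :
    qpoch a q = ∏ j ∈ Finset.range m, qpoch (a * q ^ j) (q ^ m) := by
  have hqm : ‖q ^ m‖ < 1 := by
    rw [norm_pow]; exact pow_lt_one₀ (norm_nonneg _) hq hm.ne'
  have h1 := (qp_tendsto a q hq).comp (tendsto_id.const_mul_atTop' hm : Tendsto (fun N : ℕ => m * N) atTop atTop)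
  have h2 : Tendsto (fun N : ℕ => ∏ j ∈ Finset.range m, ∏ k ∈ Finset.range N, (1 - a * q ^ j * (q ^ m) ^ k)) atTop
      (𝓝 (∏ j ∈ Finset.range m, qpoch (a * q ^ j) (q ^ m))) :=
    tendsto_finsetProd _ (fun j _ => qp_tendsto _ _ hqm)
  refine tendsto_nhds_unique h1 (h2.congr ?_)
  intro N
  simp only [Function.comp]
  rw [prod_range_split]
  refine Finset.prod_congr rfl fun j _ => Finset.prod_congr rfl fun k _ => ?_
  ring

lemma summable_gauss_nat (r y : ℝ) (hr0 : 0 < r) (hr : r < 1) (hy : 0 < y) :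
    Summable (fun n : ℕ => r ^ (n ^ 2) * y ^ n) := by
  apply summable_of_ratio_test_tendsto_lt_one (l := 0) zero_lt_one
  · exact Eventually.of_forall fun n => by positivity
  · have h : Tendsto (fun n : ℕ => (r * y) * (r ^ 2) ^ n) atTop (𝓝 ((r * y) * 0)) :=
      (tendsto_pow_atTop_nhds_zero_of_lt_one (by positivity) (by nlinarith)).const_mul _
    rw [mul_zero] at h
    refine h.congr fun n => ?_
    rw [Real.norm_of_nonneg (by positivity), Real.norm_of_nonneg (by positivity), eq_div_iff (by positivity)]
    ring

lemma summable_gauss (q z : ℂ) (hq0 : q ≠ 0) (hq : ‖q‖ < 1) (hz : z ≠ 0) :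
    Summable (fun n : ℤ => ‖q ^ (n * n) * z ^ n‖) := by
  have hq0' : 0 < ‖q‖ := norm_pos_iff.2 hq0
  have hz' : 0 < ‖z‖ := norm_pos_iff.2 hz
  apply Summable.of_nat_of_neg
  · refine (summable_gauss_nat ‖q‖ ‖z‖ hq0' hq hz').congr fun n => ?_
    rw [norm_mul, norm_zpow, norm_zpow]
    norm_cast
    rw [pow_two]
  · refine (summable_gauss_nat ‖q‖ ‖z‖⁻¹ hq0' hq (by positivity)).congr fun n => ?_
    rw [norm_mul, norm_zpow, norm_zpow, neg_mul_neg, zpow_neg]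
    norm_cast
    rw [pow_two, inv_pow]

/-- The theta series `∑ q^(n²) z^n`. -/
noncomputable def TT (q z : ℂ) : ℂ := ∑' n : ℤ, q ^ (n * n) * z ^ n

/-- partial product `(Q;Q)_m` -/
noncomputable def pp (Q : ℂ) (m : ℕ) : ℂ := ∏ k ∈ Finset.range m, (1 - Q * Q ^ k)

/-- `1/(Q;Q)_m`, zero for negative `m`. -/
noncomputable def ww (Q : ℂ) (m : ℤ) : ℂ := if 0 ≤ m then (pp Q m.toNat)⁻¹ else 0

lemma pow_ne_one' (Q : ℂ) (hQ : ‖Q‖ < 1) (k : ℕ) : 1 - Q * Q ^ k ≠ 0 := by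
  intro h
  have h1 : ‖Q ^ (k+1)‖ < 1 := by
    rw [norm_pow]; exact pow_lt_one₀ (norm_nonneg _) hQ (by omega)
  rw [show Q ^ (k+1) = 1 by linear_combination -h] at h1
  simp at h1

lemma pp_ne_zero (Q : ℂ) (hQ : ‖Q‖ < 1) (m : ℕ) : pp Q m ≠ 0 :=
  Finset.prod_ne_zero_iff.2 fun k _ => pow_ne_one' Q hQ k

lemma ww_rec (Q : ℂ) (hQ0 : Q ≠ 0) (hQ : ‖Q‖ < 1) (m : ℤ) : ww Q (m - 1) = (1 - Q ^ m) * ww Q m := by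
  rcases lt_trichotomy m 0 with h | h | h
  · simp [ww, show ¬ (0 ≤ m) by omega, show ¬ (1 ≤ m) by omega]
  · subst h; simp [ww]
  · obtain ⟨k, rfl⟩ : ∃ k : ℕ, m = k + 1 := ⟨(m-1).toNat, by omega⟩
    have e1 : ((k:ℤ) + 1 - 1).toNat = k := by omega
    have e2 : ((k:ℤ) + 1).toNat = k + 1 := by omega
    have h1 := pow_ne_one' Q hQ k
    have h2 := pp_ne_zero Q hQ k
    rw [ww, ww, if_pos (by omega), if_pos (by omega), e1, e2]
    have : pp Q (k+1) = pp Q k * (1 - Q * Q ^ k) := by rw [pp, Finset.prod_range_succ]; rfl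
    rw [this]
    have h3 : Q ^ ((k:ℤ)+1) = Q * Q ^ k := by rw [zpow_add_one₀ hQ0, zpow_natCast, mul_comm]
    rw [h3]
    field_simp

noncomputable def cc (Q : ℂ) (N : ℕ) (n : ℤ) : ℂ := pp Q (2 * N) * ww Q (N + n) * ww Q (N - n)

lemma cc_rec (Q : ℂ) (hQ0 : Q ≠ 0) (hQ : ‖Q‖ < 1) (N : ℕ) (n : ℤ) :
    cc Q (N + 1) n = cc Q N n * (1 + Q ^ (2 * N + 1)) + Q ^ ((N:ℤ) + 1 - n) * cc Q N (n - 1)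
      + Q ^ ((N:ℤ) + 1 + n) * cc Q N (n + 1) := by
  have ha : ww Q ((N:ℤ) + n) = (1 - Q ^ ((N:ℤ) + n + 1)) * ww Q ((N:ℤ) + n + 1) := by
    rw [← ww_rec Q hQ0 hQ]; congr 1; ring
  have ha' : ww Q ((N:ℤ) + n - 1) = (1 - Q ^ ((N:ℤ) + n)) * ww Q ((N:ℤ) + n) := ww_rec Q hQ0 hQ _
  have hb : ww Q ((N:ℤ) - n) = (1 - Q ^ ((N:ℤ) - n + 1)) * ww Q ((N:ℤ) - n + 1) := by
    rw [← ww_rec Q hQ0 hQ]; congr 1; ring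
  have hb' : ww Q ((N:ℤ) - n - 1) = (1 - Q ^ ((N:ℤ) - n)) * ww Q ((N:ℤ) - n) := ww_rec Q hQ0 hQ _
  have hp : pp Q (2 * (N + 1)) = pp Q (2 * N) * (1 - Q * Q ^ (2 * N)) * (1 - Q * Q ^ (2 * N + 1)) := by
    rw [pp, show 2 * (N + 1) = 2 * N + 1 + 1 by ring, Finset.prod_range_succ, Finset.prod_range_succ]; rfl
  unfold cc
  rw [hp]
  push_cast
  rw [show (N:ℤ) + 1 + n = N + n + 1 by ring, show (N:ℤ) + 1 - n = N - n + 1 by ring,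
    show (N:ℤ) + (n - 1) = N + n - 1 by ring, show (N:ℤ) - (n - 1) = N - n + 1 by ring,
    show (N:ℤ) + (n + 1) = N + n + 1 by ring, show (N:ℤ) - (n + 1) = N - n - 1 by ring,
    ha', hb', ha, hb]
  have hx : Q ^ (2 * N) = Q ^ ((N:ℤ) + n) * Q ^ ((N:ℤ) - n) := by
    rw [← zpow_add₀ hQ0, ← zpow_natCast]; congr 1; push_cast; ring
  rw [zpow_add_one₀ hQ0, zpow_add_one₀ hQ0, pow_succ, hx]
  ring

lemma hasSum_congr_of {f g : ℤ → ℂ} {a b : ℂ} (h1 : f = g) (h2 : a = b) : HasSum f a ↔ HasSum g b := by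
  rw [h1, h2]

lemma finite_jtp (q z : ℂ) (hq0 : q ≠ 0) (hq : ‖q‖ < 1) (hz : z ≠ 0) (N : ℕ) :
    HasSum (fun n : ℤ => cc (q ^ 2) N n * (q ^ (n * n) * z ^ n))
      (∏ k ∈ Finset.range N, ((1 + z * q ^ (2 * k + 1)) * (1 + z⁻¹ * q ^ (2 * k + 1)))) := by
  have hQ0 : q ^ 2 ≠ 0 := pow_ne_zero _ hq0
  have hQ : ‖q ^ 2‖ < 1 := by rw [norm_pow]; exact pow_lt_one₀ (norm_nonneg _) hq (by norm_num)
  induction N with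
  | zero =>
    have := hasSum_single (f := fun n : ℤ => cc (q ^ 2) 0 n * (q ^ (n * n) * z ^ n)) 0 (by
      intro n hn
      simp only [cc, ww]
      rcases lt_or_gt_of_ne hn with h | h
      · simp [show ¬ (0 ≤ n) by omega]
      · simp [show ¬ (n ≤ 0) by omega])
    simpa [cc, ww, pp] using this
  | succ N ih =>
    rw [Finset.prod_range_succ]
    have h1 := ih.mul_right (1 + q ^ (4 * N + 2))
    have h2 := ((Equiv.subRight (1:ℤ)).hasSum_iff.2 ih).mul_right (z * q ^ (2 * N + 1))
    have h3 := ((Equiv.addRight (1:ℤ)).hasSum_iff.2 ih).mul_right (z⁻¹ * q ^ (2 * N + 1))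
    have h := (h1.add h2).add h3
    refine (hasSum_congr_of ?_ ?_).2 h
    · funext n
      simp only [Function.comp, Equiv.subRight_apply, Equiv.coe_addRight]
      rw [cc_rec _ hQ0 hQ]
      have e1 : (q ^ 2) ^ ((N:ℤ) + 1 - n) * q ^ (n * n) * z ^ n
          = q ^ ((n-1) * (n-1)) * z ^ (n - 1) * (z * q ^ (2 * N + 1)) := by
        rw [← zpow_natCast q (2 * N + 1), ← zpow_natCast q 2, ← zpow_mul, zpow_sub_one₀ hz]
        field_simp
        rw [← zpow_add₀ hq0, ← zpow_add₀ hq0]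
        congr 1; push_cast; ring
      have e2 : (q ^ 2) ^ ((N:ℤ) + 1 + n) * q ^ (n * n) * z ^ n
          = q ^ ((n+1) * (n+1)) * z ^ (n + 1) * (z⁻¹ * q ^ (2 * N + 1)) := by
        rw [← zpow_natCast q (2 * N + 1), ← zpow_natCast q 2, ← zpow_mul, zpow_add_one₀ hz]
        field_simp
        rw [← zpow_add₀ hq0, ← zpow_add₀ hq0]
        congr 1; push_cast; ring
      linear_combination (cc (q ^ 2) N (n-1)) * e1 + (cc (q ^ 2) N (n+1)) * e2
    · have hzz : z * z⁻¹ = 1 := mul_inv_cancel₀ hz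
      generalize (∏ k ∈ Finset.range N, (1 + z * q ^ (2 * k + 1)) * (1 + z⁻¹ * q ^ (2 * k + 1))) = P
      linear_combination P * q ^ (4 * N + 2) * hzz

lemma jtp (q z : ℂ) (hq0 : q ≠ 0) (hq : ‖q‖ < 1) (hz : z ≠ 0) :
    TT q z = qpoch (q ^ 2) (q ^ 2) * qpoch (-(z * q)) (q ^ 2) * qpoch (-(z⁻¹ * q)) (q ^ 2) := by
  have hQ0 : q ^ 2 ≠ 0 := pow_ne_zero _ hq0
  have hQ : ‖q ^ 2‖ < 1 := by rw [norm_pow]; exact pow_lt_one₀ (norm_nonneg _) hq (by norm_num)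
  have hE : qpoch (q ^ 2) (q ^ 2) ≠ 0 := qp_ne_zero' _ _ hQ hQ
  have hpp : Tendsto (fun m => pp (q ^ 2) m) atTop (𝓝 (qpoch (q ^ 2) (q ^ 2))) := qp_tendsto _ _ hQ
  have hpi : Tendsto (fun m => (pp (q ^ 2) m)⁻¹) atTop (𝓝 (qpoch (q ^ 2) (q ^ 2))⁻¹) := hpp.inv₀ hE
  obtain ⟨B, hB⟩ := hpp.norm.bddAbove_range
  obtain ⟨C, hC⟩ := hpi.norm.bddAbove_range
  have hB' : ∀ m, ‖pp (q ^ 2) m‖ ≤ B := fun m => hB ⟨m, rfl⟩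
  have hC' : ∀ m, ‖(pp (q ^ 2) m)⁻¹‖ ≤ C := fun m => hC ⟨m, rfl⟩
  have hB0 : 0 ≤ B := (norm_nonneg _).trans (hB' 0)
  have hC0 : 0 ≤ C := (norm_nonneg _).trans (hC' 0)
  have hw : ∀ m, ‖ww (q ^ 2) m‖ ≤ C := by
    intro m
    unfold ww
    split_ifs
    · exact hC' _
    · simpa using hC0
  have hwt : ∀ n : ℤ, Tendsto (fun N : ℕ => ww (q ^ 2) (N + n)) atTop (𝓝 (qpoch (q ^ 2) (q ^ 2))⁻¹) := by
    intro n
    have h1 : Tendsto (fun N : ℕ => ((N:ℤ) + n).toNat) atTop atTop := by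
      rw [tendsto_atTop]
      intro b
      filter_upwards [eventually_ge_atTop (b + n.natAbs)] with N hN
      omega
    refine (hpi.comp h1).congr' ?_
    filter_upwards [eventually_ge_atTop n.natAbs] with N hN
    simp only [Function.comp, ww]
    rw [if_pos (by omega)]
  have hct : ∀ n : ℤ, Tendsto (fun N : ℕ => cc (q ^ 2) N n) atTop (𝓝 (qpoch (q ^ 2) (q ^ 2))⁻¹) := by
    intro n
    have h1 := hpp.comp (tendsto_id.const_mul_atTop' (by norm_num : 0 < 2) : Tendsto (fun N : ℕ => 2 * N) atTop atTop)
    have h2 := (h1.mul (hwt n)).mul (hwt (-n))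
    have h3 : qpoch (q ^ 2) (q ^ 2) * (qpoch (q ^ 2) (q ^ 2))⁻¹ * (qpoch (q ^ 2) (q ^ 2))⁻¹
      = (qpoch (q ^ 2) (q ^ 2))⁻¹ := by field_simp
    rw [h3] at h2
    exact h2
  have hlim := tendsto_tsum_of_dominated_convergence (𝓕 := atTop)
    (f := fun (N : ℕ) (n : ℤ) => cc (q ^ 2) N n * (q ^ (n * n) * z ^ n))
    (g := fun n : ℤ => (qpoch (q ^ 2) (q ^ 2))⁻¹ * (q ^ (n * n) * z ^ n))
    (bound := fun n : ℤ => (B * C * C) * ‖q ^ (n * n) * z ^ n‖)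
    ((summable_gauss q z hq0 hq hz).mul_left _)
    (fun n => (hct n).mul_const _)
    (Eventually.of_forall fun N n => by
      rw [norm_mul]
      gcongr
      unfold cc
      rw [norm_mul, norm_mul]
      gcongr
      · exact hB' _
      · exact hw _
      · exact hw _)
  have hfin : Tendsto (fun N : ℕ => ∏ k ∈ Finset.range N, ((1 + z * q ^ (2 * k + 1)) * (1 + z⁻¹ * q ^ (2 * k + 1))))
      atTop (𝓝 (qpoch (-(z * q)) (q ^ 2) * qpoch (-(z⁻¹ * q)) (q ^ 2))) := by
    refine ((qp_tendsto (-(z * q)) _ hQ).mul (qp_tendsto (-(z⁻¹ * q)) _ hQ)).congr fun N => ?_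
    rw [← Finset.prod_mul_distrib]
    refine Finset.prod_congr rfl fun k _ => ?_
    ring
  have heq := tendsto_nhds_unique (hlim.congr fun N => (finite_jtp q z hq0 hq hz N).tsum_eq) hfin
  rw [tsum_mul_left] at heq
  unfold TT
  rw [mul_assoc, ← heq]
  field_simp

lemma TT_inv (q z : ℂ) : TT q z⁻¹ = TT q z := by
  unfold TT
  rw [← (Equiv.neg ℤ).tsum_eq]
  refine tsum_congr fun n => ?_
  simp

lemma TT_shift (q z : ℂ) (hq0 : q ≠ 0) (hz : z ≠ 0) : q * z * TT q (q ^ 2 * z) = TT q z := by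
  unfold TT
  rw [← (Equiv.addRight (1:ℤ)).tsum_eq (fun n : ℤ => q ^ (n * n) * z ^ n), ← tsum_mul_left]
  refine tsum_congr fun n => ?_
  simp only [Equiv.coe_addRight]
  rw [mul_zpow, zpow_add_one₀ hz, ← zpow_natCast q 2, ← zpow_mul,
    show (n+1)*(n+1) = n * n + ((2:ℕ):ℤ) * n + 1 by push_cast; ring, zpow_add_one₀ hq0, zpow_add₀ hq0]
  ring

lemma tsum_split (m : ℕ) [NeZero m] (f : ℤ → ℂ) (hf : Summable f) :
    ∑' n, f n = ∑ j : Fin m, ∑' n : ℤ, f (m * n + j) := by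
  have hs : Summable (fun p : Fin m × ℤ => f (m * p.2 + p.1)) := by
    have := ((Int.divModEquiv m).symm.summable_iff.2 hf)
    have := (Equiv.prodComm (Fin m) ℤ).summable_iff.2 this
    refine this.congr fun p => ?_
    simp [Int.divModEquiv, mul_comm]
  rw [← (Int.divModEquiv m).symm.tsum_eq f, ← (Equiv.prodComm (Fin m) ℤ).tsum_eq]
  have e : ∀ p : Fin m × ℤ, f ((Int.divModEquiv m).symm ((Equiv.prodComm (Fin m) ℤ) p)) = f (m * p.2 + p.1) := by
    intro p
    simp [Int.divModEquiv, mul_comm]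
  simp_rw [e]
  rw [hs.tsum_prod, tsum_fintype]

lemma double_sum (a b : ℤ → ℂ) (ha : Summable fun n => ‖a n‖) (hb : Summable fun n => ‖b n‖) (s : ℤ) :
    HasSum (fun k : ℤ => ∑' n : ℤ, a (k + s * n) * b n) ((∑' n, a n) * ∑' n, b n) := by
  let e : ℤ × ℤ ≃ ℤ × ℤ :=
    { toFun := fun p => (p.1 + s * p.2, p.2)
      invFun := fun p => (p.1 - s * p.2, p.2)
      left_inv := fun p => by simp
      right_inv := fun p => by simp }
  have hs : Summable (fun p : ℤ × ℤ => a p.1 * b p.2) := summable_mul_of_summable_norm ha hb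
  have hs' : Summable (fun p : ℤ × ℤ => a (p.1 + s * p.2) * b p.2) := e.summable_iff.2 hs
  rw [tsum_mul_tsum_of_summable_norm ha hb, ← e.tsum_eq (fun p : ℤ × ℤ => a p.1 * b p.2)]
  exact hs'.hasSum.prod_fiberwise (fun k => (hs'.prod_factor k).hasSum)

lemma TT_summable (q z : ℂ) (hq0 : q ≠ 0) (hq : ‖q‖ < 1) (hz : z ≠ 0) :
    Summable (fun n : ℤ => q ^ (n * n) * z ^ n) := (summable_gauss q z hq0 hq hz).of_norm

lemma pow_norm_lt (q : ℂ) (hq : ‖q‖ < 1) (m : ℕ) (hm : m ≠ 0) : ‖q ^ m‖ < 1 := by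
  rw [norm_pow]; exact pow_lt_one₀ (norm_nonneg _) hq hm

lemma tsum_shift (f : ℤ → ℂ) (s : ℤ) : ∑' n, f (n + s) = ∑' n, f n :=
  (Equiv.addRight s).tsum_eq f

lemma TT_prod (q x y : ℂ) (hq0 : q ≠ 0) (hq : ‖q‖ < 1) (hx : x ≠ 0) (hy : y ≠ 0) :
    TT q (x * y) * TT q (x * y⁻¹) = TT (q ^ 2) (x ^ 2) * TT (q ^ 2) (y ^ 2)
      + q * x * y * TT (q ^ 2) (q ^ 2 * x ^ 2) * TT (q ^ 2) (q ^ 2 * y ^ 2) := by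
  have h := double_sum _ _ (summable_gauss q (x * y) hq0 hq (mul_ne_zero hx hy))
    (summable_gauss q (x * y⁻¹) hq0 hq (mul_ne_zero hx (inv_ne_zero hy))) 1
  have h2 := h.tsum_eq
  rw [tsum_split 2 _ h.summable, Fin.sum_univ_two] at h2
  unfold TT
  rw [← h2]
  congr 1
  · rw [← tsum_mul_left]
    refine tsum_congr fun v => ?_
    rw [← tsum_mul_right, ← tsum_shift _ (-v)]
    refine tsum_congr fun u => ?_
    simp only [Fin.val_zero]
    rw [← zpow_natCast q 2, ← zpow_natCast x 2, ← zpow_natCast y 2, mul_zpow, mul_zpow, inv_zpow', ← zpow_mul, ← zpow_mul, ← zpow_mul, ← zpow_mul]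
    have e1 : ∀ A B C D E F : ℂ, A * (B * C) * (D * (E * F)) = (A * D) * (B * E) * (C * F) := by intros; ring
    have e2 : ∀ A B C D : ℂ, A * B * (C * D) = (A * C) * B * D := by intros; ring
    refine (e1 _ _ _ _ _ _).trans (Eq.trans ?_ (e2 _ _ _ _).symm)
    simp only [← zpow_add₀ hq0, ← zpow_add₀ hx, ← zpow_add₀ hy]
    congr 1
    · congr 1
      · congr 1; push_cast; ring
      · congr 1; push_cast; ring
    · congr 1; push_cast; ring
  · rw [← tsum_mul_left, ← tsum_mul_left]
    refine tsum_congr fun v => ?_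
    rw [← tsum_mul_right, ← tsum_shift _ (-v)]
    refine tsum_congr fun u => ?_
    simp only [Fin.val_one]
    have e0 : q * x * y = q ^ (1:ℤ) * x ^ (1:ℤ) * y ^ (1:ℤ) := by simp
    rw [e0, ← zpow_natCast q 2, ← zpow_natCast x 2, ← zpow_natCast y 2, mul_zpow, mul_zpow, mul_zpow, mul_zpow, inv_zpow', ← zpow_mul, ← zpow_mul, ← zpow_mul, ← zpow_mul, ← zpow_mul, ← zpow_mul]
    have e1 : ∀ A B C D E F : ℂ, A * (B * C) * (D * (E * F)) = (A * D) * (B * E) * (C * F) := by intros; ring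
    have e2 : ∀ q x y A B C D E F : ℂ, (q * x * y) * (A * (B * C)) * (D * (E * F)) = (q * A * B * D * E) * (x * C) * (y * F) := by intros; ring
    refine (e1 _ _ _ _ _ _).trans (Eq.trans ?_ (e2 _ _ _ _ _ _ _ _ _).symm)
    simp only [← zpow_add₀ hq0, ← zpow_add₀ hx, ← zpow_add₀ hy]
    congr 1
    · congr 1
      · congr 1; push_cast; ring
      · congr 1; push_cast; ring
    · congr 1; push_cast; ring

lemma TT_dissect (q z : ℂ) (hq0 : q ≠ 0) (hq : ‖q‖ < 1) (hz : z ≠ 0) :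
    TT q z = TT (q ^ 25) (z ^ 5) + q * z * TT (q ^ 25) (q ^ 10 * z ^ 5)
      + q ^ 4 * z ^ 2 * TT (q ^ 25) (q ^ 20 * z ^ 5)
      + q ^ 4 * (z ^ 2)⁻¹ * TT (q ^ 25) ((q ^ 20)⁻¹ * z ^ 5)
      + q * z⁻¹ * TT (q ^ 25) ((q ^ 10)⁻¹ * z ^ 5) := by
  have key : ∀ j s : ℤ, ∑' n : ℤ, (q ^ ((5 * n + j) * (5 * n + j)) * z ^ (5 * n + j))
      = q ^ ((j - 5 * s) * (j - 5 * s)) * z ^ (j - 5 * s) * TT (q ^ 25) (q ^ (10 * (j - 5 * s)) * z ^ 5) := by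
    intro j s
    unfold TT
    rw [← tsum_mul_left, ← tsum_shift _ (-s)]
    refine tsum_congr fun n => ?_
    rw [← zpow_natCast q 25, ← zpow_natCast z 5, mul_zpow, ← zpow_mul, ← zpow_mul, ← zpow_mul]
    have e1 : ∀ A B C D E : ℂ, A * B * (C * (D * E)) = (A * C * D) * (B * E) := by intros; ring
    rw [e1]
    simp only [← zpow_add₀ hq0, ← zpow_add₀ hz]
    congr 1
    · congr 1; push_cast; ring
    · congr 1; push_cast; ring
  rw [TT, tsum_split 5 _ (TT_summable q z hq0 hq hz), Fin.sum_univ_five]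
  rw [show ((5:ℕ):ℤ) = 5 from rfl, key _ 0, key _ 0, key _ 0, key _ 1, key _ 1]
  rw [show (((0 : Fin 5) : ℕ) : ℤ) - 5 * 0 = 0 from rfl, show (((1 : Fin 5) : ℕ) : ℤ) - 5 * 0 = 1 from rfl,
    show (((2 : Fin 5) : ℕ) : ℤ) - 5 * 0 = 2 from rfl, show (((3 : Fin 5) : ℕ) : ℤ) - 5 * 1 = -2 from rfl,
    show (((4 : Fin 5) : ℕ) : ℤ) - 5 * 1 = -1 from rfl]
  have z2 : z ^ (2:ℤ) = z ^ 2 := zpow_ofNat z 2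
  have q4 : q ^ (4:ℤ) = q ^ 4 := zpow_ofNat q 4
  have q10 : q ^ (10:ℤ) = q ^ 10 := zpow_ofNat q 10
  have q20 : q ^ (20:ℤ) = q ^ 20 := zpow_ofNat q 20
  norm_num [zpow_neg, z2, q4, q10, q20]

lemma negone_zpow (a b c : ℤ) (h : a = b + 2 * c) : (-1 : ℂ) ^ a = (-1) ^ b := by
  rw [h, zpow_add₀ (by norm_num), zpow_mul]
  norm_num

lemma quintuple_sum (g w : ℂ) (hg0 : g ≠ 0) (hg : ‖g‖ < 1) (hw : w ≠ 0) :
    TT g (-w) * TT (g ^ 2) (-(g ^ 2 * w ^ 2)) = TT (g ^ 6) (-g ^ 2) *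
      (TT (g ^ 3) (g ^ 2 * w ^ 3) - g * w * TT (g ^ 3) (g ^ 4 * w ^ 3)) := by
  have h := double_sum _ _ (summable_gauss g (-w) hg0 hg (neg_ne_zero.2 hw))
    (summable_gauss (g ^ 2) (-(g ^ 2 * w ^ 2)) (pow_ne_zero 2 hg0) (pow_norm_lt g hg 2 (by norm_num))
      (by simp [hg0, hw])) (-2)
  have h2 := h.tsum_eq
  rw [tsum_split 3 _ h.summable, Fin.sum_univ_three, show ((3:ℕ):ℤ) = 3 from rfl,
    show (((0 : Fin 3) : ℕ) : ℤ) = 0 from rfl, show (((1 : Fin 3) : ℕ) : ℤ) = 1 from rfl,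
    show (((2 : Fin 3) : ℕ) : ℤ) = 2 from rfl] at h2
  have m1 : (-1 : ℂ) ≠ 0 := by norm_num
  have gen : ∀ j i : ℤ, ∑' n : ℤ, g ^ ((3 * j + i + -2 * n) * (3 * j + i + -2 * n)) * (-w) ^ (3 * j + i + -2 * n) *
      ((g ^ 2) ^ (n * n) * (-(g ^ 2 * w ^ 2)) ^ n)
      = (-1) ^ i * g ^ (3 * (j * j) + (2 + 2 * i) * j + i * i) * w ^ (3 * j + i) * TT (g ^ 6) (-g ^ (2 - 4 * i)) := by
    intro j i
    unfold TT
    rw [← tsum_mul_left, ← tsum_shift _ j]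
    refine tsum_congr fun n => ?_
    rw [neg_eq_neg_one_mul w, neg_eq_neg_one_mul (g ^ 2 * w ^ 2), neg_eq_neg_one_mul (g ^ (2 - 4 * i)),
      ← zpow_natCast g 2, ← zpow_natCast g 6, ← zpow_natCast w 2]
    simp only [mul_zpow, ← zpow_mul]
    have e1 : ∀ A B C D E F G : ℂ, A * (B * C) * (D * (E * (F * G))) = (B * E) * (A * D * F) * (C * G) := by
      intros; ring
    have e2 : ∀ A B C D E F : ℂ, A * B * C * (D * (E * F)) = (A * E) * (B * D * F) * C := by intros; ring
    refine (e1 _ _ _ _ _ _ _).trans (Eq.trans ?_ (e2 _ _ _ _ _ _).symm)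
    simp only [← zpow_add₀ hg0, ← zpow_add₀ hw, ← zpow_add₀ m1]
    congr 1
    · congr 1
      · apply negone_zpow _ _ (j - n); ring
      · congr 1; push_cast; ring
    · congr 1; push_cast; ring
  simp only [gen] at h2
  have g6 : g ^ 6 ≠ 0 := pow_ne_zero _ hg0
  have t1 : TT (g ^ 6) (-g ^ (2 - 4 * (1:ℤ))) = TT (g ^ 6) (-g ^ 2) := by
    rw [← TT_inv]; congr 1
    rw [inv_neg, ← zpow_neg]; norm_num [zpow_ofNat]
  have t2 : TT (g ^ 6) (-g ^ (2 - 4 * (2:ℤ))) = 0 := by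
    have hz : (-g ^ (2 - 4 * (2:ℤ))) = (-g ^ 6)⁻¹ := by
      rw [inv_neg, show (2 - 4 * (2:ℤ)) = -6 by norm_num, zpow_neg]; norm_num [zpow_ofNat]
    rw [hz]
    have h3 := TT_shift (g ^ 6) (-g ^ 6)⁻¹ g6 (inv_ne_zero (neg_ne_zero.2 g6))
    have h4 : (g ^ 6) ^ 2 * (-g ^ 6)⁻¹ = -g ^ 6 := by field_simp
    have h5 : g ^ 6 * (-g ^ 6)⁻¹ = -1 := by field_simp
    rw [h4, h5, ← TT_inv (g ^ 6) (-g ^ 6)] at h3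
    linear_combination (-1/2) * h3
  have t0 : TT (g ^ 6) (-g ^ (2 - (0:ℤ))) = TT (g ^ 6) (-g ^ 2) := by
    norm_num [zpow_ofNat]
  simp only [t0, t1, t2, mul_zero, tsum_zero, add_zero, tsum_mul_right] at h2
  rw [show TT g (-w) * TT (g ^ 2) (-(g ^ 2 * w ^ 2)) = _ from h2.symm]
  have s0 : ∑' n : ℤ, (-1 : ℂ) ^ (0:ℤ) * g ^ (3 * (n * n) + 2 * n) * w ^ (3 * n) = TT (g ^ 3) (g ^ 2 * w ^ 3) := by
    unfold TT
    refine tsum_congr fun n => ?_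
    rw [← zpow_natCast g 2, ← zpow_natCast g 3, ← zpow_natCast w 3, mul_zpow, ← zpow_mul, ← zpow_mul, ← zpow_mul,
      zpow_add₀ hg0, zpow_zero]
    push_cast; ring
  have s1 : ∑' n : ℤ, (-1 : ℂ) ^ (1:ℤ) * g ^ (3 * (n * n) + (2 + 2 * 1) * n + 1 * 1) * w ^ (3 * n + 1)
      = -(g * w * TT (g ^ 3) (g ^ 4 * w ^ 3)) := by
    unfold TT
    rw [← tsum_mul_left, ← tsum_neg]
    refine tsum_congr fun n => ?_
    rw [← zpow_natCast g 4, ← zpow_natCast g 3, ← zpow_natCast w 3, mul_zpow, ← zpow_mul, ← zpow_mul, ← zpow_mul,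
      zpow_add₀ hg0, zpow_add₀ hg0, zpow_add₀ hw, zpow_one]
    push_cast; norm_num; ring
  rw [s1, s0]
  ring

lemma qp_split2 (a q : ℂ) (hq : ‖q‖ < 1) : qpoch a q = qpoch a (q ^ 2) * qpoch (a * q) (q ^ 2) := by
  rw [qp_split 2 (by norm_num) a q hq]
  simp [Finset.prod_range_succ]

lemma phiNeg_eq (q : ℂ) (hq0 : q ≠ 0) (hq : ‖q‖ < 1) : phiNeg q = TT q (-1) := by
  have hQ := pow_norm_lt q hq 2 (by norm_num)
  have hE := qp_ne_zero' _ _ hQ hQ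
  rw [phiNeg, jtp q (-1) hq0 hq (by norm_num), qp_split2 q q hq]
  rw [show q * q = q ^ 2 by ring, show -(-1 * q) = q by ring, show -((-1 : ℂ)⁻¹ * q) = q by norm_num]
  field_simp

lemma euler_eq (r : ℂ) (hr0 : r ≠ 0) (hr : ‖r‖ < 1) : qpoch (r ^ 2) (r ^ 2) = TT (r ^ 3) (-r) := by
  have hQ := pow_norm_lt r hr 2 (by norm_num)
  have hQ3 := pow_norm_lt r hr 3 (by norm_num)
  rw [jtp (r ^ 3) (-r) (pow_ne_zero _ hr0) hQ3 (neg_ne_zero.2 hr0), qp_split 3 (by norm_num) _ _ hQ]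
  simp only [Finset.prod_range_succ, Finset.prod_range_zero, one_mul]
  rw [show -(-r * r ^ 3) = r ^ 4 by ring, show -((-r)⁻¹ * r ^ 3) = r ^ 2 by field_simp]
  ring_nf

lemma TT_merge (g u : ℂ) (hg0 : g ≠ 0) (hg : ‖g‖ < 1) (hu : u ≠ 0) :
    TT (g ^ 2) (-u) * TT (g ^ 2) (-(g ^ 2 / u)) * qpoch (g ^ 2) (g ^ 2)
      = qpoch (g ^ 4) (g ^ 4) ^ 2 * TT g (-(u / g)) := by
  have hQ := pow_norm_lt g hg 2 (by norm_num)
  have h2 : g ^ 2 ≠ 0 := pow_ne_zero _ hg0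
  rw [jtp (g ^ 2) (-u) h2 hQ (neg_ne_zero.2 hu), jtp (g ^ 2) (-(g ^ 2 / u)) h2 hQ (neg_ne_zero.2 (div_ne_zero h2 hu)),
    jtp g (-(u / g)) hg0 hg (neg_ne_zero.2 (div_ne_zero hu hg0)), qp_split2 (-(-(u / g) * g)) _ hQ,
    qp_split2 (-((-(u / g))⁻¹ * g)) _ hQ]
  rw [show -(-(u / g) * g) = u by field_simp, show -((-(u / g))⁻¹ * g) = g ^ 2 / u by field_simp,
    show -(-u * g ^ 2) = u * g ^ 2 by ring, show -((-u)⁻¹ * g ^ 2) = g ^ 2 / u by field_simp,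
    show -(-(g ^ 2 / u) * g ^ 2) = g ^ 2 / u * g ^ 2 by ring,
    show -((-(g ^ 2 / u))⁻¹ * g ^ 2) = u by field_simp, show (g ^ 2) ^ 2 = g ^ 4 by ring]
  ring

lemma qp_mul_neg (a q : ℂ) (hq : ‖q‖ < 1) : qpoch a q * qpoch (-a) q = qpoch (a ^ 2) (q ^ 2) := by
  unfold qpoch
  rw [← (qp_mult a q hq).tprod_mul (qp_mult (-a) q hq)]
  refine tprod_congr fun k => ?_
  ring

lemma TT_sq (g z : ℂ) (hg0 : g ≠ 0) (hg : ‖g‖ < 1) (hz : z ≠ 0) :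
    TT g z * TT g (-z) * qpoch (g ^ 4) (g ^ 4) = qpoch (g ^ 2) (g ^ 2) ^ 2 * TT (g ^ 2) (-z ^ 2) := by
  have hQ := pow_norm_lt g hg 2 (by norm_num)
  have h2 : g ^ 2 ≠ 0 := pow_ne_zero _ hg0
  rw [jtp g z hg0 hg hz, jtp g (-z) hg0 hg (neg_ne_zero.2 hz),
    jtp (g ^ 2) (-z ^ 2) h2 hQ (neg_ne_zero.2 (pow_ne_zero _ hz))]
  have e1 := qp_mul_neg (z * g) _ hQ
  have e2 := qp_mul_neg (z⁻¹ * g) _ hQ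
  rw [show -(-z * g) = z * g by ring, show -((-z)⁻¹ * g) = z⁻¹ * g by field_simp,
    show -(-z ^ 2 * g ^ 2) = (z * g) ^ 2 by ring, show -((-z ^ 2)⁻¹ * g ^ 2) = (z⁻¹ * g) ^ 2 by field_simp,
    ← e1, ← e2, show (g ^ 2) ^ 2 = g ^ 4 by ring]
  ring

lemma TT_t1t3 (p : ℂ) (hp0 : p ≠ 0) (hp : ‖p‖ < 1) :
    qpoch (p ^ 5) (p ^ 5) * TT (p ^ 5) (-p ^ 4) * TT (p ^ 5) (-p ^ 2) * qpoch (p ^ 2) (p ^ 2)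
      = qpoch p p * qpoch (p ^ 10) (p ^ 10) ^ 3 := by
  have h5 := pow_norm_lt p hp 5 (by norm_num)
  have h2 := pow_norm_lt p hp 2 (by norm_num)
  have n5 : p ^ 5 ≠ 0 := pow_ne_zero _ hp0
  rw [jtp (p ^ 5) (-p ^ 4) n5 h5 (neg_ne_zero.2 (pow_ne_zero _ hp0)),
    jtp (p ^ 5) (-p ^ 2) n5 h5 (neg_ne_zero.2 (pow_ne_zero _ hp0)), qp_split2 p p hp,
    qp_split2 (p ^ 5) _ h5, qp_split 5 (by norm_num) p (p ^ 2) h2]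
  simp only [Finset.prod_range_succ, Finset.prod_range_zero, one_mul]
  rw [show -(-p ^ 4 * p ^ 5) = p ^ 9 by ring, show -((-p ^ 4)⁻¹ * p ^ 5) = p by field_simp,
    show -(-p ^ 2 * p ^ 5) = p ^ 7 by ring, show -((-p ^ 2)⁻¹ * p ^ 5) = p ^ 3 by field_simp]
  ring_nf

lemma cyc_prod (z y : ℂ) (hz : z ^ 4 + z ^ 3 + z ^ 2 + z + 1 = 0) :
    (1 - y) * (1 - z * y) * (1 - z ^ 2 * y) * (1 - z ^ 3 * y) * (1 - z ^ 4 * y) = 1 - y ^ 5 := by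
  have h5 : z ^ 5 = 1 := by linear_combination (z - 1) * hz
  have a1 : (1 - z * y) * (1 - z ^ 4 * y) = 1 - (z + z ^ 4) * y + y ^ 2 := by linear_combination y ^ 2 * h5
  have a2 : (1 - z ^ 2 * y) * (1 - z ^ 3 * y) = 1 - (z ^ 2 + z ^ 3) * y + y ^ 2 := by linear_combination y ^ 2 * h5
  have a3 : (z + z ^ 4) * (z ^ 2 + z ^ 3) = -1 := by linear_combination hz + (z + z ^ 2) * h5
  have a4 : z ^ 2 + z ^ 3 = -1 - (z + z ^ 4) := by linear_combination hz
  calc _ = (1 - y) * ((1 - z * y) * (1 - z ^ 4 * y)) * ((1 - z ^ 2 * y) * (1 - z ^ 3 * y)) := by ring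
    _ = _ := by
      rw [a1, a2]
      linear_combination (1 - y) * y ^ 2 * a3 - (1 - y) * y * (1 + y ^ 2) * a4

lemma qp_cyc (z x Q : ℂ) (hQ : ‖Q‖ < 1) (hz : z ^ 4 + z ^ 3 + z ^ 2 + z + 1 = 0) :
    qpoch x Q * qpoch (z * x) Q * qpoch (z ^ 2 * x) Q * qpoch (z ^ 3 * x) Q * qpoch (z ^ 4 * x) Q
      = qpoch (x ^ 5) (Q ^ 5) := by
  have m := fun a => qp_mult a Q hQ
  unfold qpoch
  rw [← (m _).tprod_mul (m _), ← ((m _).mul (m _)).tprod_mul (m _),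
    ← (((m _).mul (m _)).mul (m _)).tprod_mul (m _), ← ((((m _).mul (m _)).mul (m _)).mul (m _)).tprod_mul (m _)]
  refine tprod_congr fun k => ?_
  have := cyc_prod z (x * Q ^ k) hz
  rw [← pow_mul, mul_comm 5 k, pow_mul]
  linear_combination this

lemma euler_norm (z q : ℂ) (hq : ‖q‖ < 1) (hz : z ^ 4 + z ^ 3 + z ^ 2 + z + 1 = 0) :
    qpoch q q * qpoch (z * q) (z * q) * qpoch (z ^ 2 * q) (z ^ 2 * q) * qpoch (z ^ 3 * q) (z ^ 3 * q)
      * qpoch (z ^ 4 * q) (z ^ 4 * q) * qpoch (q ^ 25) (q ^ 25) = qpoch (q ^ 5) (q ^ 5) ^ 6 := by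
  have h5 : z ^ 5 = 1 := by linear_combination (z - 1) * hz
  have hzn : ‖z‖ = 1 := by
    have : ‖z‖ ^ 5 = 1 := by rw [← norm_pow, h5, norm_one]
    exact (pow_eq_one_iff_of_nonneg (norm_nonneg _) (by norm_num)).1 this
  have hQ := pow_norm_lt q hq 5 (by norm_num)
  have hj : ∀ j : ℕ, qpoch (z ^ j * q) (z ^ j * q) = qpoch (z ^ j * q) (q ^ 5) * qpoch ((z ^ 2) ^ j * q ^ 2) (q ^ 5)
      * qpoch ((z ^ 3) ^ j * q ^ 3) (q ^ 5) * qpoch ((z ^ 4) ^ j * q ^ 4) (q ^ 5) * qpoch (q ^ 5) (q ^ 5) := by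
    intro j
    have e5 : (z ^ j * q) ^ 5 = q ^ 5 := by
      rw [mul_pow, ← pow_mul, mul_comm j, pow_mul, h5, one_pow, one_mul]
    rw [qp_split 5 (by norm_num) _ (z ^ j * q) (by rw [norm_mul, norm_pow, hzn]; simpa using hq), e5]
    simp only [Finset.prod_range_succ, Finset.prod_range_zero, one_mul]
    have e5' : (z ^ j * q) * (z ^ j * q) ^ 4 = q ^ 5 := by rw [← e5]; ring
    rw [e5']
    ring_nf
  have h0 := hj 0
  have h1 := hj 1
  have h2 := hj 2
  have h3 := hj 3
  have h4 := hj 4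
  simp only [pow_zero, one_mul, pow_one] at h0 h1
  have c1 := qp_cyc z q (q ^ 5) hQ hz
  have c2 := qp_cyc (z ^ 2) (q ^ 2) (q ^ 5) hQ (by linear_combination hz + (z ^ 3 + z) * h5)
  have c3 := qp_cyc (z ^ 3) (q ^ 3) (q ^ 5) hQ (by linear_combination hz + (z ^ 7 + z ^ 2 + z ^ 4 + z) * h5)
  have c4 := qp_cyc (z ^ 4) (q ^ 4) (q ^ 5) hQ
    (by linear_combination hz + (z ^ 11 + z ^ 6 + z + z ^ 7 + z ^ 2 + z ^ 3) * h5)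
  have e : qpoch (q ^ 5) (q ^ 5) = qpoch (q ^ 5) ((q ^ 5) ^ 5) * qpoch ((q ^ 2) ^ 5) ((q ^ 5) ^ 5)
      * qpoch ((q ^ 3) ^ 5) ((q ^ 5) ^ 5) * qpoch ((q ^ 4) ^ 5) ((q ^ 5) ^ 5) * qpoch (q ^ 25) (q ^ 25) := by
    rw [qp_split 5 (by norm_num) _ _ hQ]
    simp only [Finset.prod_range_succ, Finset.prod_range_zero, one_mul]
    ring_nf
  rw [← c1, ← c2, ← c3, ← c4] at e
  rw [h0, h1, h2, h3, h4]
  linear_combination (-qpoch (q ^ 5) (q ^ 5) ^ 5) * e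

lemma TT_neg_ne_zero (p : ℂ) (hp0 : p ≠ 0) (hp : ‖p‖ < 1) (j : ℕ) (hj : j < 5) :
    TT (p ^ 5) (-p ^ j) ≠ 0 := by
  have h5 := pow_norm_lt p hp 5 (by norm_num)
  have h10 := pow_norm_lt (p ^ 5) h5 2 (by norm_num)
  rw [jtp (p ^ 5) (-p ^ j) (pow_ne_zero _ hp0) h5 (neg_ne_zero.2 (pow_ne_zero _ hp0))]
  refine mul_ne_zero (mul_ne_zero (qp_ne_zero' _ _ h10 h10) (qp_ne_zero' _ _ h10 ?_)) (qp_ne_zero' _ _ h10 ?_)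
  · rw [show -(-p ^ j * p ^ 5) = p ^ (j + 5) by ring]
    exact pow_norm_lt p hp _ (by omega)
  · have : -((-p ^ j)⁻¹ * p ^ 5) = p ^ (5 - j) := by
      rw [pow_sub₀ _ hp0 hj.le]; field_simp
    rw [this]
    exact pow_norm_lt p hp _ (by omega)

lemma weier_rank2 (p : ℂ) (hp0 : p ≠ 0) (hp : ‖p‖ < 1) (a b : ℤ) :
    TT (p ^ 5) (-p ^ (5 - (a + b))) * TT (p ^ 5) (-p ^ (5 - (a - b)))
      = p ^ a * ((p ^ (-a) * TT (p ^ 10) (p ^ (10 - 2 * a))) * TT (p ^ 10) (p ^ (2 * b))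
        - TT (p ^ 10) (p ^ (2 * a)) * (p ^ (-b) * TT (p ^ 10) (p ^ (10 - 2 * b)))) := by
  have h5 := pow_norm_lt p hp 5 (by norm_num)
  have n5 : p ^ 5 ≠ 0 := pow_ne_zero _ hp0
  have n10 : p ^ 10 ≠ 0 := pow_ne_zero _ hp0
  have nz : ∀ n : ℤ, p ^ n ≠ 0 := fun n => zpow_ne_zero n hp0
  have hprod := TT_prod (p ^ 5) (-p ^ (5 - a)) (p ^ b) n5 h5 (neg_ne_zero.2 (nz _)) (nz _)
  have p5 : p ^ 5 = p ^ (5:ℤ) := (zpow_ofNat p 5).symm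
  have p10 : p ^ 10 = p ^ (10:ℤ) := (zpow_ofNat p 10).symm
  have z2 : ∀ n : ℤ, (p ^ n) ^ 2 = p ^ (2 * n) := fun n => by
    rw [← zpow_natCast, ← zpow_mul, mul_comm]; rfl
  rw [show -p ^ (5 - a) * p ^ b = -p ^ (5 - (a - b)) by rw [neg_mul, ← zpow_add₀ hp0]; congr 2; ring,
    show -p ^ (5 - a) * (p ^ b)⁻¹ = -p ^ (5 - (a + b)) by
      rw [← zpow_neg, neg_mul, ← zpow_add₀ hp0]; congr 2; ring,
    neg_sq, z2, z2, show (p ^ 5) ^ 2 = p ^ 10 by ring] at hprod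
  have s1 := TT_shift (p ^ 10) (p ^ (-10 + 2 * b)) n10 (nz _)
  have s2 := TT_shift (p ^ 10) (p ^ (-(2 * a))) n10 (nz _)
  rw [zpow_neg, TT_inv, ← zpow_neg] at s2
  rw [← TT_inv (p ^ 10) (p ^ (-10 + 2 * b)), ← zpow_neg] at s1
  rw [show -(-10 + 2 * b) = 10 - 2 * b by ring] at s1
  have a1 : (p ^ 10) ^ 2 * p ^ (-10 + 2 * b) = p ^ 10 * p ^ (2 * b) := by
    rw [p10, z2, ← zpow_add₀ hp0, ← zpow_add₀ hp0]; congr 1; ring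
  have a2 : (p ^ 10) ^ 2 * p ^ (-(2 * a)) = p ^ 10 * p ^ (2 * (5 - a)) := by
    rw [p10, z2, ← zpow_add₀ hp0, ← zpow_add₀ hp0]; congr 1; ring
  rw [a1] at s1
  rw [a2] at s2
  rw [mul_comm, hprod, ← s1, ← s2, show 2 * (5 - a) = 10 - 2 * a by ring]
  have c1 : p ^ a * p ^ (-a) = 1 := by rw [← zpow_add₀ hp0]; simp
  have c2 : p ^ 5 * p ^ (5 - a) * p ^ b
      = p ^ a * (p ^ 10 * p ^ (-(2 * a))) * (p ^ (-b) * (p ^ 10 * p ^ (-10 + 2 * b))) := by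
    rw [p5, p10]
    simp only [← zpow_add₀ hp0]
    congr 1; ring
  generalize TT (p ^ 10) (p ^ (10 - 2 * a)) = A
  linear_combination (-(TT (p ^ 10) (p ^ 10 * p ^ (10 - 2 * a))) * TT (p ^ 10) (p ^ 10 * p ^ (2 * b))) * c2
    - A * TT (p ^ 10) (p ^ (2 * b)) * c1

lemma weier_rels (p : ℂ) (hp0 : p ≠ 0) (hp : ‖p‖ < 1) (x1 x2 x3 x4 x5 : ℂ)
    (h1 : x1 = TT (p ^ 5) (-p ^ 4)) (h2 : x2 = TT (p ^ 5) (-p ^ 3)) (h3 : x3 = TT (p ^ 5) (-p ^ 2))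
    (h4 : x4 = TT (p ^ 5) (-p)) (h5 : x5 = TT (p ^ 5) (-1)) :
    x2 ^ 2 * x3 * x5 = x1 * x3 * x4 ^ 2 + p * x1 ^ 2 * x2 * x4 ∧
    x3 ^ 2 * x4 * x2 = p * x2 ^ 2 * x1 * x3 + x4 ^ 2 * x5 * x1 := by
  obtain ⟨D, hD, hplu⟩ : ∃ D : ℤ → ℤ → ℂ,
      (∀ a b, TT (p ^ 5) (-p ^ (5 - (a + b))) * TT (p ^ 5) (-p ^ (5 - (a - b))) = p ^ a * D a b) ∧
      ∀ a b c, D a 0 * D c b - D b 0 * D c a + D c 0 * D b a = 0 := by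
    refine ⟨_, weier_rank2 p hp0 hp, ?_⟩
    intro a b c
    ring
  have e1 : TT (p ^ 5) (-p ^ (4:ℤ)) = x1 := by rw [h1]; norm_num [zpow_ofNat]
  have e2 : TT (p ^ 5) (-p ^ (3:ℤ)) = x2 := by rw [h2]; norm_num [zpow_ofNat]
  have e3 : TT (p ^ 5) (-p ^ (2:ℤ)) = x3 := by rw [h3]; norm_num [zpow_ofNat]
  have e4 : TT (p ^ 5) (-p ^ (1:ℤ)) = x4 := by rw [h4]; norm_num [zpow_ofNat]
  have e5 : TT (p ^ 5) (-p ^ (0:ℤ)) = x5 := by rw [h5]; norm_num [zpow_ofNat]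
  have e6 : TT (p ^ 5) (-p ^ (-1:ℤ)) = x4 := by
    rw [h4, ← TT_inv, inv_neg, ← zpow_neg]; norm_num
  have e7 : TT (p ^ 5) (-p ^ (-2:ℤ)) = x3 := by
    rw [h3, ← TT_inv, inv_neg, ← zpow_neg]; norm_num [zpow_ofNat]
  have d10 := hD 1 0
  have d20 := hD 2 0
  have d30 := hD 3 0
  have d40 := hD 4 0
  have d21 := hD 2 1
  have d41 := hD 4 1
  have d42 := hD 4 2
  have d43 := hD 4 3
  have d32 := hD 3 2
  norm_num only [e1, e2, e3, e4, e5, e6, e7] at d10 d20 d30 d40 d21 d41 d42 d43 d32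
  have q1 : p ^ (1:ℤ) = p := zpow_one p
  have q2 : p ^ (2:ℤ) = p ^ 2 := zpow_ofNat p 2
  have q3 : p ^ (3:ℤ) = p ^ 3 := zpow_ofNat p 3
  have q4 : p ^ (4:ℤ) = p ^ 4 := zpow_ofNat p 4
  simp only [e1, e2, e3, e4, e5, e6, e7, q1, q2, q3, q4, zpow_one] at d10 d20 d30 d40 d21 d41 d42 d43 d32
  have A := hplu 1 2 4
  have B := hplu 2 3 4
  constructor
  · linear_combination (x5 * x3) * d20 + p ^ 2 * D 2 0 * d41 - (x3 * x1) * d40 - p ^ 4 * D 4 0 * d21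
      - p * (x4 * x2) * d10 - p * p * D 1 0 * d42 - p ^ 6 * A
  · linear_combination (x4 * x2) * d30 + p ^ 3 * D 3 0 * d42 - p * (x3 * x1) * d20 - p ^ 3 * D 2 0 * d43
      - (x5 * x1) * d40 - p ^ 4 * D 4 0 * d32 - p ^ 7 * B

lemma level10 (p x1 x2 x3 x4 x5 : ℂ) (n1 : x1 ≠ 0) (n2 : x2 ≠ 0) (n3 : x3 ≠ 0) (n4 : x4 ≠ 0) (n5 : x5 ≠ 0)
    (R2 : x2 ^ 2 * x3 * x5 = x1 * x3 * x4 ^ 2 + p * x1 ^ 2 * x2 * x4)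
    (R4 : x3 ^ 2 * x4 * x2 = p * x2 ^ 2 * x1 * x3 + x4 ^ 2 * x5 * x1) :
    (p * x5 ^ 2 * x1 ^ 2 + 2 * x5 * x3 ^ 3 + 4 * p ^ 2 * x3 * x1 ^ 3) * (x1 * x4 ^ 2 * x2 ^ 3 * x3 ^ 2)
      = x5 ^ 2 * (2 * x2 ^ 5 * x3 ^ 5 - p * x1 ^ 5 * x4 ^ 5) := by
  obtain ⟨k, hk⟩ : ∃ k, k * (x3 * x4) = p * x1 * x2 := ⟨p * x1 * x2 / (x3 * x4), by field_simp⟩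
  have r2 : x5 * x2 ^ 2 = (1 + k) * x1 * x4 ^ 2 := by
    apply mul_left_cancel₀ n3
    linear_combination R2 - x1 * x4 * hk
  have r4 : x5 * x1 * x4 = (1 - k) * x2 * x3 ^ 2 := by
    apply mul_left_cancel₀ n4
    linear_combination -R4 + x2 * x3 * hk
  have hk1 : 1 + k ≠ 0 := by
    intro h
    rw [h] at r2
    simp [n5, n2] at r2
  have S : (1 + k) * x1 ^ 2 * x4 ^ 3 = (1 - k) * x2 ^ 3 * x3 ^ 2 := by
    linear_combination x2 ^ 2 * r4 - x1 * x4 * r2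
  have T1 : p * x5 * x1 ^ 2 = k * (1 - k) * x3 ^ 3 := by
    apply mul_left_cancel₀ (mul_ne_zero n2 n4)
    linear_combination (-(x5 * x1 * x4)) * hk + k * x3 * x4 * r4
  have T2 : p ^ 2 * x1 ^ 3 * (1 + k) = k ^ 2 * x3 ^ 2 * x5 := by
    apply mul_left_cancel₀ (mul_ne_zero (pow_ne_zero 2 n2) (pow_ne_zero 2 n4))
    linear_combination (-(x1 * x4 ^ 2 * (1 + k)) * (p * x1 * x2 + k * (x3 * x4))) * hk - k ^ 2 * x3 ^ 2 * x4 ^ 2 * r2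
  have T4 : p * x5 * x1 ^ 4 * x4 ^ 3 * (1 + k) = k * (1 - k) ^ 2 * x2 ^ 3 * x3 ^ 5 := by
    linear_combination x1 ^ 2 * x4 ^ 3 * (1 + k) * T1 + k * (1 - k) * x3 ^ 3 * S
  apply mul_left_cancel₀ hk1
  linear_combination ((1 + k) * x5 * (x1 * x4 ^ 2 * x2 ^ 3 * x3 ^ 2)) * T1
    + (4 * x3 * (x1 * x4 ^ 2 * x2 ^ 3 * x3 ^ 2)) * T2
    - (2 * (1 + k) * x5 * x2 ^ 3 * x3 ^ 5) * r2 + (x5 * x1 * x4 ^ 2) * T4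

lemma phi_dissect (q : ℂ) (hq0 : q ≠ 0) (hq : ‖q‖ < 1) :
    phiNeg q = TT (q ^ 25) (-1) + (-2 * q * TT (q ^ 25) (-q ^ 10)) + 2 * q ^ 4 * TT (q ^ 25) (-q ^ 20) := by
  rw [phiNeg_eq q hq0 hq, TT_dissect q (-1) hq0 hq (by norm_num)]
  have a1 : TT (q ^ 25) ((q ^ 10)⁻¹ * (-1) ^ 5) = TT (q ^ 25) (-q ^ 10) := by
    rw [← TT_inv]; congr 1; field_simp
  have a2 : TT (q ^ 25) ((q ^ 20)⁻¹ * (-1) ^ 5) = TT (q ^ 25) (-q ^ 20) := by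
    rw [← TT_inv]; congr 1; field_simp
  rw [a1, a2, show q ^ 10 * (-1) ^ 5 = -q ^ 10 by ring, show q ^ 20 * (-1) ^ 5 = -q ^ 20 by ring,
    show (-1 : ℂ) ^ 5 = -1 by norm_num]
  norm_num
  ring

lemma euler_dissect_r (r : ℂ) (hr0 : r ≠ 0) (hr : ‖r‖ < 1) :
    ∃ a b : ℂ, qpoch (r ^ 2) (r ^ 2) = a - r ^ 2 * qpoch (r ^ 50) (r ^ 50) - r ^ 4 * b ∧
      a * TT (r ^ 25) (-r ^ 15) = qpoch (r ^ 50) (r ^ 50) * TT (r ^ 25) (-r ^ 5) ∧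
      b * TT (r ^ 25) (-r ^ 5) = qpoch (r ^ 50) (r ^ 50) * TT (r ^ 25) (-r ^ 15) := by
  have hr3 := pow_norm_lt r hr 3 (by norm_num)
  have hg := pow_norm_lt r hr 25 (by norm_num)
  have h50 := pow_norm_lt r hr 50 (by norm_num)
  have h100 := pow_norm_lt r hr 100 (by norm_num)
  have np : ∀ n : ℕ, r ^ n ≠ 0 := fun n => pow_ne_zero _ hr0
  have hE4 := qp_ne_zero' _ _ h100 h100
  have hE2 := qp_ne_zero' _ _ h50 h50
  have eu : TT (r ^ 150) (-r ^ 50) = qpoch (r ^ 100) (r ^ 100) := by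
    have := euler_eq (r ^ 50) (np _) h50
    rw [← pow_mul, ← pow_mul] at this
    exact this.symm
  refine ⟨TT (r ^ 75) (-r ^ 5) + r ^ 10 * TT (r ^ 75) (-r ^ 55),
    TT (r ^ 75) (-r ^ 35) - r ^ 10 * TT (r ^ 75) (-r ^ 65), ?_, ?_, ?_⟩
  · rw [euler_eq r hr0 hr, TT_dissect (r ^ 3) (-r) (np _) hr3 (neg_ne_zero.2 hr0)]
    have e := euler_eq (r ^ 25) (np _) hg
    rw [← pow_mul, ← pow_mul] at e
    norm_num only at e
    rw [e]
    have a1 : TT ((r ^ 3) ^ 25) (((r ^ 3) ^ 10)⁻¹ * (-r) ^ 5) = TT (r ^ 75) (-r ^ 25) := by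
      rw [← TT_inv, ← pow_mul]; congr 1; field_simp
    have a2 : TT ((r ^ 3) ^ 25) (((r ^ 3) ^ 20)⁻¹ * (-r) ^ 5) = TT (r ^ 75) (-r ^ 55) := by
      rw [← TT_inv, ← pow_mul]; congr 1; field_simp
    rw [a1, a2, show (r ^ 3) ^ 10 * (-r) ^ 5 = -r ^ 35 by ring, show (r ^ 3) ^ 20 * (-r) ^ 5 = -r ^ 65 by ring,
      show (r ^ 3) ^ 25 = r ^ 75 by ring, show (-r) ^ 5 = -r ^ 5 by ring]
    field_simp
    ring
  · have Q := quintuple_sum (r ^ 25) (-(r ^ 15)⁻¹) (np _) hg (neg_ne_zero.2 (inv_ne_zero (np _)))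
    have M := TT_merge (r ^ 25) (r ^ 30) (np _) hg (np _)
    have Sq := TT_sq (r ^ 25) (r ^ 15) (np _) hg (np _)
    rw [neg_neg, TT_inv,
      show -((r ^ 25) ^ 2 * (-(r ^ 15)⁻¹) ^ 2) = -r ^ 20 by field_simp,
      show (r ^ 25) ^ 2 * (-(r ^ 15)⁻¹) ^ 3 = -r ^ 5 by field_simp,
      show (r ^ 25) ^ 4 * (-(r ^ 15)⁻¹) ^ 3 = -r ^ 55 by field_simp,
      show r ^ 25 * (-(r ^ 15)⁻¹) = -r ^ 10 by field_simp] at Q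
    rw [show (r ^ 25) ^ 2 / r ^ 30 = r ^ 20 by field_simp, show r ^ 30 / r ^ 25 = r ^ 5 by field_simp] at M
    simp only [← pow_mul] at Q M Sq
    norm_num only at Q M Sq
    rw [eu] at Q
    apply mul_left_cancel₀ (pow_ne_zero 2 hE4)
    linear_combination (-TT (r ^ 25) (-r ^ 15) * qpoch (r ^ 100) (r ^ 100)) * Q
      + TT (r ^ 50) (-r ^ 20) * Sq + qpoch (r ^ 50) (r ^ 50) * M
  · have Q := quintuple_sum (r ^ 25) (-(r ^ 5)⁻¹) (np _) hg (neg_ne_zero.2 (inv_ne_zero (np _)))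
    have M := TT_merge (r ^ 25) (r ^ 40) (np _) hg (np _)
    have Sq := TT_sq (r ^ 25) (r ^ 5) (np _) hg (np _)
    have Sh := TT_shift (r ^ 75) (-(r ^ 65)⁻¹) (np _) (neg_ne_zero.2 (inv_ne_zero (np _)))
    rw [neg_neg, TT_inv,
      show -((r ^ 25) ^ 2 * (-(r ^ 5)⁻¹) ^ 2) = -r ^ 40 by field_simp,
      show (r ^ 25) ^ 2 * (-(r ^ 5)⁻¹) ^ 3 = -r ^ 35 by field_simp,
      show (r ^ 25) ^ 4 * (-(r ^ 5)⁻¹) ^ 3 = -r ^ 85 by field_simp,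
      show r ^ 25 * (-(r ^ 5)⁻¹) = -r ^ 20 by field_simp] at Q
    rw [show (r ^ 25) ^ 2 / r ^ 40 = r ^ 10 by field_simp, show r ^ 40 / r ^ 25 = r ^ 15 by field_simp] at M
    rw [← inv_neg, TT_inv, inv_neg, show (r ^ 75) ^ 2 * (-(r ^ 65)⁻¹) = -r ^ 85 by field_simp,
      show r ^ 75 * (-(r ^ 65)⁻¹) = -r ^ 10 by field_simp] at Sh
    simp only [← pow_mul] at Q M Sq
    norm_num only at Q M Sq
    rw [eu] at Q
    rw [← Sh]
    apply mul_left_cancel₀ (pow_ne_zero 2 hE4)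
    linear_combination (-TT (r ^ 25) (-r ^ 5) * qpoch (r ^ 100) (r ^ 100)) * Q
      + TT (r ^ 50) (-r ^ 40) * Sq + qpoch (r ^ 50) (r ^ 50) * M

lemma alg_phi (z A b c : ℂ) (hz : z ^ 4 + z ^ 3 + z ^ 2 + z + 1 = 0) :
    1 * ((A + z * b + z ^ 4 * c) * (A + z ^ 2 * b + z ^ 3 * c) * (A + z ^ 3 * b + z ^ 2 * c) * (A + z ^ 4 * b + z * c))
    + z ^ 2 * ((A + b + c) * (A + z ^ 2 * b + z ^ 3 * c) * (A + z ^ 3 * b + z ^ 2 * c) * (A + z ^ 4 * b + z * c))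
    + z ^ 4 * ((A + b + c) * (A + z * b + z ^ 4 * c) * (A + z ^ 3 * b + z ^ 2 * c) * (A + z ^ 4 * b + z * c))
    + z * ((A + b + c) * (A + z * b + z ^ 4 * c) * (A + z ^ 2 * b + z ^ 3 * c) * (A + z ^ 4 * b + z * c))
    + z ^ 3 * ((A + b + c) * (A + z * b + z ^ 4 * c) * (A + z ^ 2 * b + z ^ 3 * c) * (A + z ^ 3 * b + z ^ 2 * c))
    = 5 * (A ^ 2 * c ^ 2 - A * b ^ 3 - b * c ^ 3) := by
  linear_combination (
    b ^ 1 * c ^ 3 * ((5) * z ^ 0 + (-5) * z ^ 1 + (5) * z ^ 5 + (-4) * z ^ 6 + (1) * z ^ 7 + (1) * z ^ 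
    8 + (1) * z ^ 9 + (1) * z ^ 10) + A ^ 1 * b ^ 3 * ((5) * z ^ 0 + (-5) * z ^ 1 + (1) * z ^ 4 + (4) * 
    z ^ 5 + (-2) * z ^ 6 + (1) * z ^ 7 + (1) * z ^ 8) + A ^ 2 * c ^ 2 * ((-5) * z ^ 0 + (5) * z ^ 1 + 
    (1) * z ^ 2 + (1) * z ^ 3 + (1) * z ^ 4 + (2) * z ^ 6) + A ^ 4 * ((1) * z ^ 0) + A ^ 3 * c ^ 1 * 
    ((2) * z ^ 1 + (1) * z ^ 2 + (1) * z ^ 4) + A ^ 3 * b ^ 1 * ((2) * z ^ 1 + (1) * z ^ 2 + (1) * z ^ 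
    4) + A ^ 2 * b ^ 1 * c ^ 1 * ((3) * z ^ 2 + (2) * z ^ 3 + (3) * z ^ 4 + (2) * z ^ 5 + (1) * z ^ 6 + 
    (1) * z ^ 8) + A ^ 2 * b ^ 2 * ((1) * z ^ 2 + (1) * z ^ 3 + (2) * z ^ 4 + (2) * z ^ 5 + (-1) * z ^ 
    6 + (1) * z ^ 7) + A ^ 1 * b ^ 1 * c ^ 2 * ((1) * z ^ 3 + (1) * z ^ 4 + (4) * z ^ 5 + (2) * z ^ 6 + 
    (1) * z ^ 7 + (2) * z ^ 8 + (1) * z ^ 10) + A ^ 1 * b ^ 2 * c ^ 1 * ((1) * z ^ 3 + (2) * z ^ 4 + 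
    (2) * z ^ 5 + (2) * z ^ 6 + (2) * z ^ 7 + (3) * z ^ 8 + (-1) * z ^ 10 + (1) * z ^ 11) + b ^ 2 * c ^ 
    2 * ((1) * z ^ 5 + (1) * z ^ 6 + (-1) * z ^ 7 + (4) * z ^ 8 + (-1) * z ^ 9 + (1) * z ^ 10 + (1) * z 
    ^ 11) + b ^ 3 * c ^ 1 * ((1) * z ^ 5 + (-1) * z ^ 6 + (1) * z ^ 7 + (2) * z ^ 8 + (1) * z ^ 9 + 
    (-1) * z ^ 10 + (1) * z ^ 11) + A ^ 1 * c ^ 3 * ((2) * z ^ 5 + (1) * z ^ 6 + (1) * z ^ 8) + c ^ 4 * 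
    ((1) * z ^ 8) + b ^ 4 * ((1) * z ^ 8)) * hz

lemma alg_euler (z F H : ℂ) (hz : z ^ 4 + z ^ 3 + z ^ 2 + z + 1 = 0) :
    1 * ((F ^ 2 - z * F * H - z ^ 2 * H ^ 2) * (F ^ 2 - z ^ 2 * F * H - z ^ 4 * H ^ 2)
        * (F ^ 2 - z ^ 3 * F * H - z * H ^ 2) * (F ^ 2 - z ^ 4 * F * H - z ^ 3 * H ^ 2))
    + z ^ 3 * ((F ^ 2 - F * H - H ^ 2) * (F ^ 2 - z ^ 2 * F * H - z ^ 4 * H ^ 2)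
        * (F ^ 2 - z ^ 3 * F * H - z * H ^ 2) * (F ^ 2 - z ^ 4 * F * H - z ^ 3 * H ^ 2))
    + z * ((F ^ 2 - F * H - H ^ 2) * (F ^ 2 - z * F * H - z ^ 2 * H ^ 2)
        * (F ^ 2 - z ^ 3 * F * H - z * H ^ 2) * (F ^ 2 - z ^ 4 * F * H - z ^ 3 * H ^ 2))
    + z ^ 4 * ((F ^ 2 - F * H - H ^ 2) * (F ^ 2 - z * F * H - z ^ 2 * H ^ 2)
        * (F ^ 2 - z ^ 2 * F * H - z ^ 4 * H ^ 2) * (F ^ 2 - z ^ 4 * F * H - z ^ 3 * H ^ 2))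
    + z ^ 2 * ((F ^ 2 - F * H - H ^ 2) * (F ^ 2 - z * F * H - z ^ 2 * H ^ 2)
        * (F ^ 2 - z ^ 2 * F * H - z ^ 4 * H ^ 2) * (F ^ 2 - z ^ 3 * F * H - z * H ^ 2))
    = 5 * (2 * F ^ 6 * H ^ 2 - F * H ^ 7) := by
  linear_combination (
    F ^ 1 * H ^ 7 * ((5) * z ^ 0 + (-5) * z ^ 1 + (5) * z ^ 5 + (-4) * z ^ 6 + (1) * z ^ 7 + (1) * z ^ 
    8 + (1) * z ^ 9 + (1) * z ^ 10) + F ^ 6 * H ^ 2 * ((-10) * z ^ 0 + (8) * z ^ 1 + (2) * z ^ 6) + F ^ 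
    8 * ((1) * z ^ 0) + F ^ 7 * H ^ 1 * ((-2) * z ^ 1 + (-1) * z ^ 2 + (-1) * z ^ 4) + F ^ 4 * H ^ 4 * 
    ((1) * z ^ 2 + (1) * z ^ 3 + (1) * z ^ 4 + (-3) * z ^ 5 + (-4) * z ^ 6 + (-1) * z ^ 10) + F ^ 5 * H 
    ^ 3 * ((3) * z ^ 2 + (2) * z ^ 3 + (3) * z ^ 4) + F ^ 3 * H ^ 5 * ((-1) * z ^ 3 + (-1) * z ^ 4 + 
    (-4) * z ^ 5 + (-1) * z ^ 6 + (-1) * z ^ 7) + F ^ 2 * H ^ 6 * ((-1) * z ^ 4 + (-1) * z ^ 5 + (2) * 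
    z ^ 6 + (-1) * z ^ 7 + (1) * z ^ 8 + (2) * z ^ 10) + H ^ 8 * ((1) * z ^ 7 + (-1) * z ^ 8 + (1) * z 
    ^ 9)) * hz

lemma partial_frac (K d0 d1 d2 d3 d4 w0 w1 w2 w3 w4 : ℂ) (h0 : d0 ≠ 0) (h1 : d1 ≠ 0) (h2 : d2 ≠ 0)
    (h3 : d3 ≠ 0) (h4 : d4 ≠ 0) :
    (w0 * (K / d0) + w1 * (K / d1) + w2 * (K / d2) + w3 * (K / d3) + w4 * (K / d4)) * (d0 * d1 * d2 * d3 * d4)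
    = K * (w0 * (d1 * d2 * d3 * d4) + w1 * (d0 * d2 * d3 * d4) + w2 * (d0 * d1 * d3 * d4)
      + w3 * (d0 * d1 * d2 * d4) + w4 * (d0 * d1 * d2 * d3)) := by
  field_simp

lemma euler_dissect (q : ℂ) (hq0 : q ≠ 0) (hq : ‖q‖ < 1) (p : ℂ) (hp : q ^ 5 = p) (F G : ℂ)
    (hF : F = TT (p ^ 5) (-p ^ 3) * TT (p ^ 5) (-p ^ 2)) (hG : G = TT (p ^ 5) (-p ^ 4) * TT (p ^ 5) (-p)) :
    qpoch q q * (F * G) = qpoch (p ^ 5) (p ^ 5) * (F ^ 2 - q * F * G - q ^ 2 * G ^ 2) := by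
  obtain ⟨r, hr⟩ : ∃ r : ℂ, r ^ 2 = q := IsAlgClosed.exists_pow_nat_eq q (by norm_num)
  have hr0 : r ≠ 0 := by rintro rfl; apply hq0; rw [← hr]; norm_num
  have hr1 : ‖r‖ < 1 := by
    rw [← hr, norm_pow] at hq
    by_contra h
    push Not at h
    nlinarith
  obtain ⟨a, b, h1, h2, h3⟩ := euler_dissect_r r hr0 hr1
  have np : ∀ n : ℕ, r ^ n ≠ 0 := fun n => pow_ne_zero _ hr0
  have hg := pow_norm_lt r hr1 25 (by norm_num)
  have h50 := pow_norm_lt r hr1 50 (by norm_num)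
  have h100 := pow_norm_lt r hr1 100 (by norm_num)
  have hE4 := qp_ne_zero' _ _ h100 h100
  have hE2 := qp_ne_zero' _ _ h50 h50
  have M1 := TT_merge (r ^ 25) (r ^ 30) (np _) hg (np _)
  have M2 := TT_merge (r ^ 25) (r ^ 40) (np _) hg (np _)
  rw [show (r ^ 25) ^ 2 / r ^ 30 = r ^ 20 by field_simp, show r ^ 30 / r ^ 25 = r ^ 5 by field_simp] at M1
  rw [show (r ^ 25) ^ 2 / r ^ 40 = r ^ 10 by field_simp, show r ^ 40 / r ^ 25 = r ^ 15 by field_simp] at M2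
  simp only [← pow_mul] at M1 M2
  norm_num only at M1 M2
  have hp' : p = r ^ 10 := by rw [← hp, ← hr]; ring
  have e5 : p ^ 5 = r ^ 50 := by rw [hp']; ring
  have e3 : p ^ 3 = r ^ 30 := by rw [hp']; ring
  have e2 : p ^ 2 = r ^ 20 := by rw [hp']; ring
  have e4 : p ^ 4 = r ^ 40 := by rw [hp']; ring
  rw [e5, e3, e2] at hF
  rw [e5, e4, hp'] at hG
  rw [← hF] at M1
  rw [← hG] at M2
  have ha : a * G = qpoch (r ^ 50) (r ^ 50) * F := by
    apply mul_left_cancel₀ hE2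
    linear_combination a * M2 - qpoch (r ^ 50) (r ^ 50) * M1 + qpoch (r ^ 100) (r ^ 100) ^ 2 * h2
  have hb : b * F = qpoch (r ^ 50) (r ^ 50) * G := by
    apply mul_left_cancel₀ hE2
    linear_combination b * M1 - qpoch (r ^ 50) (r ^ 50) * M2 + qpoch (r ^ 100) (r ^ 100) ^ 2 * h3
  rw [e5]
  rw [hr, show r ^ 4 = q ^ 2 by rw [← hr]; ring] at h1
  rw [h1]
  linear_combination F * ha - q ^ 2 * G * hb

lemma norm_root (z : ℂ) (hz : z ^ 4 + z ^ 3 + z ^ 2 + z + 1 = 0) : z ^ 5 = 1 ∧ ‖z‖ = 1 ∧ z ≠ 0 := by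
  have h5 : z ^ 5 = 1 := by linear_combination (z - 1) * hz
  refine ⟨h5, Complex.norm_eq_one_of_pow_eq_one h5 (by norm_num), ?_⟩
  rintro rfl
  norm_num at h5

lemma phi_norm (z q : ℂ) (hq : ‖q‖ < 1) (hz : z ^ 4 + z ^ 3 + z ^ 2 + z + 1 = 0) :
    phiNeg q * phiNeg (z * q) * phiNeg (z ^ 2 * q) * phiNeg (z ^ 3 * q) * phiNeg (z ^ 4 * q) * phiNeg (q ^ 25)
      = phiNeg (q ^ 5) ^ 6 := by
  obtain ⟨h5, hn, hz0⟩ := norm_root z hz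
  have hz2 : (z ^ 2) ^ 4 + (z ^ 2) ^ 3 + (z ^ 2) ^ 2 + z ^ 2 + 1 = 0 := by
    linear_combination (z ^ 4 - z ^ 3 + z ^ 2 - z + 1) * hz
  have N1 := euler_norm z q hq hz
  have hq2 := pow_norm_lt q hq 2 (by norm_num)
  have N2 := euler_norm (z ^ 2) (q ^ 2) hq2 hz2
  have key : ∀ w : ℂ, ‖w‖ < 1 → qpoch w w ^ 2 = phiNeg w * qpoch (w ^ 2) (w ^ 2) := by
    intro w hw
    have := pow_norm_lt w hw 2 (by norm_num)
    have := qp_ne_zero' _ _ this this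
    rw [phiNeg]; field_simp
  have hj : ∀ j : ℕ, ‖z ^ j * q‖ < 1 := fun j => by rw [norm_mul, norm_pow, hn]; simpa using hq
  have k0 := key q hq
  have k1 := key (z * q) (by simpa using hj 1)
  have k2 := key _ (hj 2)
  have k3 := key _ (hj 3)
  have k4 := key _ (hj 4)
  have k5 := key _ (pow_norm_lt q hq 5 (by norm_num))
  have k6 := key _ (pow_norm_lt q hq 25 (by norm_num))
  rw [show (z * q) ^ 2 = z ^ 2 * q ^ 2 by ring] at k1
  rw [show (z ^ 2 * q) ^ 2 = (z ^ 2) ^ 2 * q ^ 2 by ring] at k2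
  rw [show (z ^ 3 * q) ^ 2 = (z ^ 2) ^ 3 * q ^ 2 by ring] at k3
  rw [show (z ^ 4 * q) ^ 2 = (z ^ 2) ^ 4 * q ^ 2 by ring] at k4
  rw [show (q ^ 5) ^ 2 = (q ^ 2) ^ 5 by ring] at k5
  rw [show (q ^ 25) ^ 2 = (q ^ 2) ^ 25 by ring] at k6
  have h10 := pow_norm_lt _ hq2 5 (by norm_num)
  apply mul_right_cancel₀ (pow_ne_zero 6 (qp_ne_zero' _ _ h10 h10))
  rw [← mul_pow, ← k5, ← N2]
  have N1' := congrArg (fun t => t ^ 2) N1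
  simp only [mul_pow _ _ 2] at N1'
  rw [k0, k1, k2, k3, k4, k6] at N1'
  rw [show (qpoch (q ^ 5) (q ^ 5) ^ 2) ^ 6 = (qpoch (q ^ 5) (q ^ 5) ^ 6) ^ 2 by ring, ← N1']
  ring

lemma core (z q : ℂ) (hq0 : q ≠ 0) (hq : ‖q‖ < 1) (hz : z ^ 4 + z ^ 3 + z ^ 2 + z + 1 = 0) (U V : ℂ)
    (hU : U = phiNeg (q ^ 5) ^ 5) (hV : V = qpoch (q ^ 5) (q ^ 5) ^ 5) :
    1 * (U / phiNeg q) + z ^ 2 * (U / phiNeg (z * q)) + z ^ 4 * (U / phiNeg (z ^ 2 * q))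
      + z * (U / phiNeg (z ^ 3 * q)) + z ^ 3 * (U / phiNeg (z ^ 4 * q))
    = 4 * q * (1 * (V / qpoch q q) + z ^ 3 * (V / qpoch (z * q) (z * q))
      + z * (V / qpoch (z ^ 2 * q) (z ^ 2 * q))
      + z ^ 4 * (V / qpoch (z ^ 3 * q) (z ^ 3 * q)) + z ^ 2 * (V / qpoch (z ^ 4 * q) (z ^ 4 * q))) := by
  obtain ⟨h5, hn, hz0⟩ := norm_root z hz
  have hj : ∀ j : ℕ, ‖z ^ j * q‖ < 1 := fun j => by rw [norm_mul, norm_pow, hn]; simpa using hq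
  have hj1 : ‖z * q‖ < 1 := by simpa using hj 1
  have hj0 : ∀ j : ℕ, z ^ j * q ≠ 0 := fun j => mul_ne_zero (pow_ne_zero _ hz0) hq0
  have hp1 := pow_norm_lt q hq 5 (by norm_num)
  have hp0 : q ^ 5 ≠ 0 := pow_ne_zero _ hq0
  have phne : ∀ w : ℂ, ‖w‖ < 1 → phiNeg w ≠ 0 := by
    intro w hw
    have h2 := pow_norm_lt w hw 2 (by norm_num)
    exact div_ne_zero (pow_ne_zero _ (qp_ne_zero' _ _ hw hw)) (qp_ne_zero' _ _ h2 h2)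
  have pfa := partial_frac U _ _ _ _ _ 1 (z ^ 2) (z ^ 4) z (z ^ 3) (phne q hq) (phne _ hj1) (phne _ (hj 2))
    (phne _ (hj 3)) (phne _ (hj 4))
  have pfc := partial_frac V _ _ _ _ _ 1 (z ^ 3) z (z ^ 4) (z ^ 2) (qp_ne_zero' _ _ hq hq) (qp_ne_zero' _ _ hj1 hj1)
    (qp_ne_zero' _ _ (hj 2) (hj 2)) (qp_ne_zero' _ _ (hj 3) (hj 3)) (qp_ne_zero' _ _ (hj 4) (hj 4))
  set Sa := 1 * (U / phiNeg q) + z ^ 2 * (U / phiNeg (z * q)) + z ^ 4 * (U / phiNeg (z ^ 2 * q))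
      + z * (U / phiNeg (z ^ 3 * q)) + z ^ 3 * (U / phiNeg (z ^ 4 * q)) with hSa
  set Sc := 1 * (V / qpoch q q) + z ^ 3 * (V / qpoch (z * q) (z * q))
      + z * (V / qpoch (z ^ 2 * q) (z ^ 2 * q))
      + z ^ 4 * (V / qpoch (z ^ 3 * q) (z ^ 3 * q)) + z ^ 2 * (V / qpoch (z ^ 4 * q) (z ^ 4 * q)) with hSc
  have Na := phi_norm z q hq hz
  have Nc := euler_norm z q hq hz
  obtain ⟨p, hp⟩ : ∃ p, q ^ 5 = p := ⟨_, rfl⟩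
  have d0 := phi_dissect q hq0 hq
  have d1 := phi_dissect (z * q) (mul_ne_zero hz0 hq0) hj1
  have d2 := phi_dissect _ (hj0 2) (hj 2)
  have d3 := phi_dissect _ (hj0 3) (hj 3)
  have d4 := phi_dissect _ (hj0 4) (hj 4)
  have zp : ∀ j : ℕ, (z ^ j) ^ 5 = 1 := fun j => by rw [← pow_mul, mul_comm, pow_mul, h5, one_pow]
  have q25 : ∀ w : ℂ, w ^ 5 = 1 → (w * q) ^ 25 = p ^ 5 := fun w hw => by
    rw [← hp]; linear_combination q ^ 25 * ((w ^ 20 + w ^ 15 + w ^ 10 + w ^ 5 + 1) * hw)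
  have q10 : ∀ w : ℂ, w ^ 5 = 1 → (w * q) ^ 10 = p ^ 2 := fun w hw => by
    rw [← hp]; linear_combination q ^ 10 * ((w ^ 5 + 1) * hw)
  have q20 : ∀ w : ℂ, w ^ 5 = 1 → (w * q) ^ 20 = p ^ 4 := fun w hw => by
    rw [← hp]; linear_combination q ^ 20 * ((w ^ 15 + w ^ 10 + w ^ 5 + 1) * hw)
  have q5 : ∀ w : ℂ, w ^ 5 = 1 → (w * q) ^ 5 = p := fun w hw => by
    rw [← hp]; linear_combination q ^ 5 * hw
  have q25' := q25 1 (by norm_num)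
  have q10' := q10 1 (by norm_num)
  have q20' := q20 1 (by norm_num)
  rw [one_mul] at q25' q10' q20'
  rw [q25', q10', q20'] at d0
  rw [q25 z h5, q10 z h5, q20 z h5] at d1
  rw [q25 _ (zp 2), q10 _ (zp 2), q20 _ (zp 2)] at d2
  rw [q25 _ (zp 3), q10 _ (zp 3), q20 _ (zp 3)] at d3
  rw [q25 _ (zp 4), q10 _ (zp 4), q20 _ (zp 4)] at d4
  rw [hp] at hp0 hp1 hU hV Na Nc
  rw [q25'] at Na Nc
  have n1 := TT_neg_ne_zero p hp0 hp1 4 (by norm_num)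
  have n2 := TT_neg_ne_zero p hp0 hp1 3 (by norm_num)
  have n3 := TT_neg_ne_zero p hp0 hp1 2 (by norm_num)
  have n4 := TT_neg_ne_zero p hp0 hp1 1 (by norm_num)
  have n5 := TT_neg_ne_zero p hp0 hp1 0 (by norm_num)
  rw [pow_one] at n4
  rw [pow_zero] at n5
  have t13 := TT_t1t3 p hp0 hp1
  have hp5 := pow_norm_lt p hp1 5 (by norm_num)
  have ph5 := phiNeg_eq (p ^ 5) (pow_ne_zero _ hp0) hp5
  obtain ⟨F, hF⟩ : ∃ F, F = TT (p ^ 5) (-p ^ 3) * TT (p ^ 5) (-p ^ 2) := ⟨_, rfl⟩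
  obtain ⟨G, hG⟩ : ∃ G, G = TT (p ^ 5) (-p ^ 4) * TT (p ^ 5) (-p) := ⟨_, rfl⟩
  have f0 := euler_dissect q hq0 hq p hp F G hF hG
  have f1 := euler_dissect (z * q) (mul_ne_zero hz0 hq0) hj1 p (q5 z h5) F G hF hG
  have f2 := euler_dissect _ (hj0 2) (hj 2) p (q5 _ (zp 2)) F G hF hG
  have f3 := euler_dissect _ (hj0 3) (hj 3) p (q5 _ (zp 3)) F G hF hG
  have f4 := euler_dissect _ (hj0 4) (hj 4) p (q5 _ (zp 4)) F G hF hG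
  obtain ⟨x1, hx1⟩ : ∃ x, x = TT (p ^ 5) (-p ^ 4) := ⟨_, rfl⟩
  obtain ⟨x2, hx2⟩ : ∃ x, x = TT (p ^ 5) (-p ^ 3) := ⟨_, rfl⟩
  obtain ⟨x3, hx3⟩ : ∃ x, x = TT (p ^ 5) (-p ^ 2) := ⟨_, rfl⟩
  obtain ⟨x4, hx4⟩ : ∃ x, x = TT (p ^ 5) (-p) := ⟨_, rfl⟩
  obtain ⟨x5, hx5⟩ : ∃ x, x = TT (p ^ 5) (-1) := ⟨_, rfl⟩
  obtain ⟨R2, R4⟩ := weier_rels p hp0 hp1 x1 x2 x3 x4 x5 hx1 hx2 hx3 hx4 hx5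
  rw [← hx1] at hG d0 d1 d2 d3 d4 n1 t13
  rw [← hx2] at hF n2
  rw [← hx3] at hF d0 d1 d2 d3 d4 n3 t13
  rw [← hx4] at hG n4
  rw [← hx5] at d0 d1 d2 d3 d4 n5 ph5
  have L := level10 p x1 x2 x3 x4 x5 n1 n2 n3 n4 n5 R2 R4
  have hE1 := qp_ne_zero' _ _ hp1 hp1
  have hE5 := qp_ne_zero' _ _ hp5 hp5
  have h2' := pow_norm_lt p hp1 2 (by norm_num)
  have hE2 := qp_ne_zero' _ _ h2' h2'
  have h10' := pow_norm_lt p hp1 10 (by norm_num)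
  have hE10 := qp_ne_zero' _ _ h10' h10'
  have hph := phne p hp1
  have hF0 : F ≠ 0 := hF ▸ mul_ne_zero n2 n3
  have hG0 : G ≠ 0 := hG ▸ mul_ne_zero n1 n4
  -- the eta quotient identity
  have eta : phiNeg p * qpoch (p ^ 5) (p ^ 5) ^ 5 = x5 ^ 3 * x1 * x3 * qpoch p p := by
    rw [← ph5, phiNeg, phiNeg, ← pow_mul]
    norm_num only
    field_simp
    linear_combination (-1) * t13
  obtain ⟨b, hb⟩ : ∃ b, b = -2 * q * x3 := ⟨_, rfl⟩
  obtain ⟨c, hc⟩ : ∃ c, c = 2 * q ^ 4 * x1 := ⟨_, rfl⟩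
  have d0' : phiNeg q = x5 + b + c := by rw [d0, hb, hc]
  have d1' : phiNeg (z * q) = x5 + z * b + z ^ 4 * c := by rw [d1, hb, hc]; ring
  have d2' : phiNeg (z ^ 2 * q) = x5 + z ^ 2 * b + z ^ 3 * c := by
    rw [d2, hb, hc]; linear_combination (2 * q ^ 4 * x1 * z ^ 3) * h5
  have d3' : phiNeg (z ^ 3 * q) = x5 + z ^ 3 * b + z ^ 2 * c := by
    rw [d3, hb, hc]; linear_combination (2 * q ^ 4 * x1 * (z ^ 7 + z ^ 2)) * h5
  have d4' : phiNeg (z ^ 4 * q) = x5 + z ^ 4 * b + z * c := by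
    rw [d4, hb, hc]; linear_combination (2 * q ^ 4 * x1 * (z ^ 11 + z ^ 6 + z)) * h5
  have P1 := alg_phi z x5 b c hz
  rw [← d0', ← d1', ← d2', ← d3', ← d4'] at P1
  rw [P1, hU] at pfa
  rw [ph5] at Na
  have A1 : Sa * phiNeg p = 5 * (x5 ^ 2 * c ^ 2 - x5 * b ^ 3 - b * c ^ 3) * x5 := by
    apply mul_left_cancel₀ (pow_ne_zero 5 hph)
    linear_combination (-Sa) * Na + x5 * pfa
  obtain ⟨H, hH⟩ : ∃ H, H = q * G := ⟨_, rfl⟩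
  obtain ⟨k, hk⟩ : ∃ k, k * (F * G) = qpoch (p ^ 5) (p ^ 5) :=
    ⟨qpoch (p ^ 5) (p ^ 5) / (F * G), by field_simp⟩
  have hFG : F * G ≠ 0 := mul_ne_zero hF0 hG0
  have f0' : qpoch q q = k * (F ^ 2 - F * H - H ^ 2) := by
    apply mul_right_cancel₀ hFG
    rw [f0, ← hk, hH]; ring
  have f1' : qpoch (z * q) (z * q) = k * (F ^ 2 - z * F * H - z ^ 2 * H ^ 2) := by
    apply mul_right_cancel₀ hFG
    rw [f1, ← hk, hH]; ring
  have f2' : qpoch (z ^ 2 * q) (z ^ 2 * q) = k * (F ^ 2 - z ^ 2 * F * H - z ^ 4 * H ^ 2) := by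
    apply mul_right_cancel₀ hFG
    rw [f2, ← hk, hH]; ring
  have f3' : qpoch (z ^ 3 * q) (z ^ 3 * q) = k * (F ^ 2 - z ^ 3 * F * H - z * H ^ 2) := by
    apply mul_right_cancel₀ hFG
    rw [f3, ← hk, hH]; linear_combination (-(k * (F * G) * (z * q ^ 2 * G ^ 2))) * h5
  have f4' : qpoch (z ^ 4 * q) (z ^ 4 * q) = k * (F ^ 2 - z ^ 4 * F * H - z ^ 3 * H ^ 2) := by
    apply mul_right_cancel₀ hFG
    rw [f4, ← hk, hH]; linear_combination (-(k * (F * G) * (z ^ 3 * q ^ 2 * G ^ 2))) * h5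
  have P2 := alg_euler z F H hz
  have P3 : 1 * (qpoch (z * q) (z * q) * qpoch (z ^ 2 * q) (z ^ 2 * q) * qpoch (z ^ 3 * q) (z ^ 3 * q)
        * qpoch (z ^ 4 * q) (z ^ 4 * q))
      + z ^ 3 * (qpoch q q * qpoch (z ^ 2 * q) (z ^ 2 * q) * qpoch (z ^ 3 * q) (z ^ 3 * q)
        * qpoch (z ^ 4 * q) (z ^ 4 * q))
      + z * (qpoch q q * qpoch (z * q) (z * q) * qpoch (z ^ 3 * q) (z ^ 3 * q) * qpoch (z ^ 4 * q) (z ^ 4 * q))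
      + z ^ 4 * (qpoch q q * qpoch (z * q) (z * q) * qpoch (z ^ 2 * q) (z ^ 2 * q) * qpoch (z ^ 4 * q) (z ^ 4 * q))
      + z ^ 2 * (qpoch q q * qpoch (z * q) (z * q) * qpoch (z ^ 2 * q) (z ^ 2 * q) * qpoch (z ^ 3 * q) (z ^ 3 * q))
      = k ^ 4 * (5 * (2 * F ^ 6 * H ^ 2 - F * H ^ 7)) := by
    rw [f0', f1', f2', f3', f4', ← P2]
    generalize F ^ 2 - F * H - H ^ 2 = D0
    generalize F ^ 2 - z * F * H - z ^ 2 * H ^ 2 = D1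
    generalize F ^ 2 - z ^ 2 * F * H - z ^ 4 * H ^ 2 = D2
    generalize F ^ 2 - z ^ 3 * F * H - z * H ^ 2 = D3
    generalize F ^ 2 - z ^ 4 * F * H - z ^ 3 * H ^ 2 = D4
    ring
  rw [P3, hV] at pfc
  generalize qpoch q q * qpoch (z * q) (z * q) * qpoch (z ^ 2 * q) (z ^ 2 * q) * qpoch (z ^ 3 * q) (z ^ 3 * q)
    * qpoch (z ^ 4 * q) (z ^ 4 * q) = N at pfc Nc
  generalize qpoch p p = Ep at *
  generalize qpoch (p ^ 5) (p ^ 5) = Eq at *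
  generalize phiNeg p = ph at *
  have C1 : Sc * Ep = k ^ 4 * (5 * (2 * F ^ 6 * H ^ 2 - F * H ^ 7)) * Eq := by
    apply mul_left_cancel₀ (pow_ne_zero 5 hE1)
    linear_combination (-Sc) * Nc + Eq * pfc
  have L' : (p * x5 ^ 2 * x1 ^ 2 + 2 * x5 * x3 ^ 3 + 4 * p ^ 2 * x3 * x1 ^ 3) * (F ^ 3 * G ^ 2)
      = x5 ^ 2 * x1 * x3 * (2 * F ^ 5 - p * G ^ 5) := by
    rw [hF, hG]; linear_combination (x1 * x3) * L
  have A2 : Sa * ph = 20 * q ^ 3 * x5 * (p * x5 ^ 2 * x1 ^ 2 + 2 * x5 * x3 ^ 3 + 4 * p ^ 2 * x3 * x1 ^ 3) := by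
    rw [A1, hb, hc, ← hp]; ring
  have C2 : Sc * Ep * (F ^ 3 * G ^ 2) = 5 * q ^ 2 * Eq ^ 5 * (2 * F ^ 5 - p * G ^ 5) := by
    apply mul_left_cancel₀ (mul_ne_zero hF0 (pow_ne_zero 2 hG0))
    rw [C1, hH, ← hp, ← hk]; ring
  apply mul_left_cancel₀ (mul_ne_zero (mul_ne_zero hph hE1) (mul_ne_zero (pow_ne_zero 3 hF0) (pow_ne_zero 2 hG0)))
  linear_combination (Ep * (F ^ 3 * G ^ 2)) * A2 + (20 * q ^ 3 * x5 * Ep) * L' - (4 * q * ph) * C2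
    - (20 * q ^ 3 * (2 * F ^ 5 - p * G ^ 5)) * eta

lemma phi_ne_zero (w : ℂ) (hw : ‖w‖ < 1) : phiNeg w ≠ 0 := by
  have h2 := pow_norm_lt w hw 2 (by norm_num)
  exact div_ne_zero (pow_ne_zero _ (qp_ne_zero' _ _ hw hw)) (qp_ne_zero' _ _ h2 h2)

lemma hasSum_of_tsum (f : ℕ → ℂ) (s : ℂ) (h : ∑' n, f n = s) (hs : s ≠ 0) : HasSum f s := by
  have : Summable f := by
    by_contra hf
    exact hs (by rw [← h, tsum_eq_zero_of_not_summable hf])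
  exact h ▸ this.hasSum

lemma hasSum_nat_congr {f g : ℕ → ℂ} {s : ℂ} (h : ∀ n, f n = g n) : HasSum f s ↔ HasSum g s := by
  rw [funext h]

lemma coeff_zero (d : ℕ → ℂ) (h : ∀ q : ℂ, ‖q‖ < 1 → HasSum (fun n => d n * q ^ n) 0) (n : ℕ) : d n = 0 := by
  have hp : HasFPowerSeriesAt (fun _ : ℂ => (0 : ℂ)) (FormalMultilinearSeries.ofScalars ℂ d) 0 := by
    rw [hasFPowerSeriesAt_iff]
    filter_upwards [Metric.ball_mem_nhds (0 : ℂ) one_pos] with q hq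
    have := h q (by simpa using hq)
    simpa [FormalMultilinearSeries.coeff_ofScalars, mul_comm] using this
  have := hp.eq_zero
  have h2 : (FormalMultilinearSeries.ofScalars ℂ d).coeff n = 0 := by rw [this]; rfl
  simpa [FormalMultilinearSeries.coeff_ofScalars] using h2

theorem stmt_1 (c a : ℕ → ℤ)
    (hc : ∀ q : ℂ, ‖q‖ < 1 →
      ∑' n : ℕ, (c n : ℂ) * q ^ n = qpoch (q ^ 5) (q ^ 5) ^ 5 / qpoch q q)
    (ha : ∀ q : ℂ, ‖q‖ < 1 →
      ∑' n : ℕ, (a n : ℂ) * q ^ n = phiNeg (q ^ 5) ^ 5 / phiNeg q) :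
    ∀ n : ℕ, a (5 * n + 3) = 4 * c (5 * n + 2) := by
  obtain ⟨z, hz⟩ : ∃ z : ℂ, z ^ 4 + z ^ 3 + z ^ 2 + z + 1 = 0 := by
    have hp : IsPrimitiveRoot (Complex.exp (2 * Real.pi * Complex.I / (5 : ℕ))) 5 :=
      Complex.isPrimitiveRoot_exp 5 (by norm_num)
    refine ⟨Complex.exp (2 * Real.pi * Complex.I / (5 : ℕ)), ?_⟩
    have := hp.geom_sum_eq_zero (by norm_num)
    simp only [Finset.sum_range_succ, Finset.sum_range_zero] at this
    linear_combination this
  obtain ⟨h5, hn, hz0⟩ := norm_root z hz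
  have hA : ∀ q : ℂ, ‖q‖ < 1 → HasSum (fun n => (a n : ℂ) * q ^ n) (phiNeg (q ^ 5) ^ 5 / phiNeg q) := fun q hq =>
    hasSum_of_tsum _ _ (ha q hq)
      (div_ne_zero (pow_ne_zero _ (phi_ne_zero _ (pow_norm_lt q hq 5 (by norm_num)))) (phi_ne_zero q hq))
  have hC : ∀ q : ℂ, ‖q‖ < 1 → HasSum (fun n => (c n : ℂ) * q ^ n) (qpoch (q ^ 5) (q ^ 5) ^ 5 / qpoch q q) :=
    fun q hq => by
      have := pow_norm_lt q hq 5 (by norm_num)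
      exact hasSum_of_tsum _ _ (hc q hq) (div_ne_zero (pow_ne_zero _ (qp_ne_zero' _ _ this this)) (qp_ne_zero' _ _ hq hq))
  let w : ℕ → ℂ := fun n => 1 + z ^ 2 * z ^ n + z ^ 4 * (z ^ 2) ^ n + z * (z ^ 3) ^ n + z ^ 3 * (z ^ 4) ^ n
  let w' : ℕ → ℂ := fun n => 1 + z ^ 3 * z ^ n + z * (z ^ 2) ^ n + z ^ 4 * (z ^ 3) ^ n + z ^ 2 * (z ^ 4) ^ n
  let e : ℕ → ℂ := fun n => Nat.casesOn n 0 (fun m => 4 * (c m * w' m))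
  let d : ℕ → ℂ := fun n => a n * w n - e n
  have key : ∀ q : ℂ, ‖q‖ < 1 → HasSum (fun n => d n * q ^ n) 0 := by
    intro q hq
    by_cases hq0 : q = 0
    · subst hq0
      have : (fun n => d n * (0 : ℂ) ^ n) = fun _ => 0 := by
        ext n
        rcases n with _ | n
        · have : w 0 = 0 := by simp only [w, pow_zero]; linear_combination hz
          simp [d, e, this]
        · simp
      rw [this]; exact hasSum_zero
    have hj : ∀ j : ℕ, ‖z ^ j * q‖ < 1 := fun j => by rw [norm_mul, norm_pow, hn]; simpa using hq
    have hj1 : ‖z * q‖ < 1 := by simpa using hj 1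
    have zp : ∀ j : ℕ, (z ^ j * q) ^ 5 = q ^ 5 := fun j => by
      rw [mul_pow, ← pow_mul, mul_comm j, pow_mul, h5, one_pow, one_mul]
    have zp1 : (z * q) ^ 5 = q ^ 5 := by simpa using zp 1
    have K := core z q hq0 hq hz _ _ rfl rfl
    have a0 := hA q hq
    have a1 := hA _ hj1
    have a2 := hA _ (hj 2)
    have a3 := hA _ (hj 3)
    have a4 := hA _ (hj 4)
    have c0 := hC q hq
    have c1 := hC _ hj1
    have c2 := hC _ (hj 2)
    have c3 := hC _ (hj 3)
    have c4 := hC _ (hj 4)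
    rw [zp1] at a1 c1
    rw [zp] at a2 a3 a4 c2 c3 c4
    have SA := ((((a0.mul_left 1).add (a1.mul_left (z ^ 2))).add (a2.mul_left (z ^ 4))).add (a3.mul_left z)).add
      (a4.mul_left (z ^ 3))
    have SC := (((((c0.mul_left 1).add (c1.mul_left (z ^ 3))).add (c2.mul_left z)).add (c3.mul_left (z ^ 4))).add
      (c4.mul_left (z ^ 2))).mul_left (4 * q)
    rw [K] at SA
    have SE : HasSum (fun n => e n * q ^ n) (4 * q * (1 * (qpoch (q ^ 5) (q ^ 5) ^ 5 / qpoch q q)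
      + z ^ 3 * (qpoch (q ^ 5) (q ^ 5) ^ 5 / qpoch (z * q) (z * q))
      + z * (qpoch (q ^ 5) (q ^ 5) ^ 5 / qpoch (z ^ 2 * q) (z ^ 2 * q))
      + z ^ 4 * (qpoch (q ^ 5) (q ^ 5) ^ 5 / qpoch (z ^ 3 * q) (z ^ 3 * q))
      + z ^ 2 * (qpoch (q ^ 5) (q ^ 5) ^ 5 / qpoch (z ^ 4 * q) (z ^ 4 * q)))) := by
      rw [← hasSum_nat_add_iff' 1]
      simp only [Finset.sum_range_one]
      have e0 : e 0 = 0 := rfl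
      rw [e0, zero_mul, sub_zero]
      refine (hasSum_nat_congr fun n => ?_).mpr SC
      have e1 : e (n + 1) = 4 * (c n * w' n) := rfl
      rw [e1]
      simp only [w', mul_pow]
      ring
    have := SA.sub SE
    rw [sub_self] at this
    refine (hasSum_nat_congr fun n => ?_).mpr this
    simp only [d, w, mul_pow]
    ring
  intro n
  have hd := coeff_zero d key (5 * n + 3)
  have zz : ∀ j : ℕ, (z ^ j) ^ (5 * n) = 1 := fun j => by
    rw [pow_mul, ← pow_mul z, mul_comm j, pow_mul z, h5, one_pow, one_pow]
  have zz1 : z ^ (5 * n) = 1 := by simpa using zz 1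
  have hw : w (5 * n + 3) = 5 := by
    simp only [w, pow_add _ (5 * n) 3, zz, zz1]
    linear_combination (1 + (z ^ 5 + 1) + (z ^ 5 + 1) + (z ^ 10 + z ^ 5 + 1)) * h5
  have hw' : w' (5 * n + 2) = 5 := by
    simp only [w', pow_add _ (5 * n) 2, zz, zz1]
    linear_combination (1 + 1 + (z ^ 5 + 1) + (z ^ 5 + 1)) * h5
  have hd' : (a (5 * n + 3) : ℂ) * w (5 * n + 3) - 4 * (c (5 * n + 2) * w' (5 * n + 2)) = 0 := hd
  rw [hw, hw'] at hd'
  have : (a (5 * n + 3) : ℂ) = 4 * c (5 * n + 2) := by linear_combination hd' / 5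
  exact_mod_cast this
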